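/- arXiv:2002.02266 — 4 statements merged into one kernel-verified Lean document; each statement's English description precedes it below -/
import Mathlib

section
/- For every integer n ≥ 4, the polynomial Q_n(s) := (4/(n(n-1)))·(1-s^2)^2·L_{n-2}''(s) satisfies the identity Q_n''(s) = 4(n-3)(n-2)·L_{n-2}(s) for all s. (Q_n is the generalized Jacobi polynomial J_n^{-2,-2}, and this is the derivative identity ∂_s^2 J_n^{-2,-2} = 4(n-3)(n-2) L_{n-2}.) -/
/-- The Legendre polynomial of degree `n` (Rodrigues formula), as a real function. -/
noncomputable def legendre (n : ℕ) : ℝ → ℝ :=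
  fun s => (1 / ((2 : ℝ) ^ n * n.factorial)) * iteratedDeriv n (fun t : ℝ => (t ^ 2 - 1) ^ n) s

open Polynomial in
theorem iteratedDeriv_polynomial_eval (p : ℝ[X]) (k : ℕ) :
    iteratedDeriv k (fun t => p.eval t) = fun t => (derivative^[k] p).eval t := by
  induction k with
  | zero => simp
  | succ k ih =>
    rw [iteratedDeriv_succ, ih, Function.iterate_succ_apply']
    funext t
    exact Polynomial.deriv _

open Polynomial in
/-- Legendre's differential equation, for the (unnormalized) Rodrigues polynomials. -/
theorem legendre_differential_equation {R : Type*} [CommRing R] (m : ℕ) :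
    (X ^ 2 - 1) * derivative (derivative (derivative^[m] ((X ^ 2 - 1 : R[X]) ^ m)))
      + 2 * X * derivative (derivative^[m] ((X ^ 2 - 1 : R[X]) ^ m))
      = (m : R[X]) * ((m : R[X]) + 1) * derivative^[m] ((X ^ 2 - 1 : R[X]) ^ m) := by
  set w : R[X] := (X ^ 2 - 1) ^ m with hw
  have first_order : (X ^ 2 - 1) * derivative w = 2 * (m : R[X]) * X * w := by
    rcases m with _ | k
    · simp [hw]
    · simp only [hw, derivative_pow, derivative_sub, derivative_X, derivative_one, C_eq_natCast]
      push_cast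
      simp only [pow_one]
      ring
  have second_order : derivative^[2] w * X ^ 2 + 2 • (derivative w * X)
      = derivative^[2] w + (2 * m) • (derivative w * X) + (2 * m) • w := by
    have h := congrArg derivative first_order
    simp at h ⊢
    linear_combination h
  have h := congrArg (derivative^[m]) second_order
  rw [iterate_map_add, iterate_map_add, iterate_map_add,
    iterate_derivative_smul, iterate_derivative_smul, iterate_derivative_smul,
    iterate_derivative_derivative_mul_X, iterate_derivative_derivative_mul_X_sq,
    ← Function.iterate_add_apply] at h
  simp only [Function.iterate_succ_apply', nsmul_eq_mul] at h
  rcases m with _ | k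
  · simp at h ⊢
    linear_combination h
  · simp only [Nat.add_sub_cancel] at h
    push_cast at h ⊢
    linear_combination h

open Polynomial in
/-- Two derivatives of `(1 - X²)² p''`, for `p` a solution of Legendre's equation. -/
theorem derivative_derivative_sq_mul_of_legendre {R : Type*} [CommRing R] {p : R[X]} {m : ℕ}
    (h : (X ^ 2 - 1) * derivative (derivative p) + 2 * X * derivative p
      = (m : R[X]) * ((m : R[X]) + 1) * p) :
    derivative (derivative ((1 - X ^ 2) ^ 2 * derivative (derivative p)))
      = ((m : R[X]) - 1) * (m : R[X]) * ((m : R[X]) + 1) * ((m : R[X]) + 2) * p := by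
  have hd := congrArg derivative h
  have hdd := congrArg derivative hd
  simp [derivative_pow] at hd hdd ⊢
  simp only [map_ofNat] at hd hdd ⊢
  linear_combination (X ^ 2 - 1) * hdd + 2 * X * hd
    + ((m : R[X]) * ((m : R[X]) + 1) - 2) * h

/-- For `n ≥ 4`, the generalized Jacobi polynomial
`J_n^{-2,-2}(s) = (4/(n(n-1))) (1-s²)² L_{n-2}''(s)` satisfies
`∂_s² J_n^{-2,-2}(s) = 4(n-3)(n-2) L_{n-2}(s)`. -/
theorem jacobi_second_derivative_identity (n : ℕ) (hn : 4 ≤ n) (s : ℝ) :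
    iteratedDeriv 2
        (fun t : ℝ =>
          4 / ((n : ℝ) * ((n : ℝ) - 1)) * (1 - t ^ 2) ^ 2 * iteratedDeriv 2 (legendre (n - 2)) t) s
      = 4 * ((n : ℝ) - 3) * ((n : ℝ) - 2) * legendre (n - 2) s := by
  obtain ⟨m, rfl⟩ : ∃ m, n = m + 2 := ⟨n - 2, by omega⟩
  rw [Nat.add_sub_cancel]
  set w : Polynomial ℝ := Polynomial.derivative^[m] ((Polynomial.X ^ 2 - 1) ^ m) with hw
  set c : ℝ := 1 / ((2 : ℝ) ^ m * m.factorial) with hc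
  have legendre_eq : legendre m = fun t => (Polynomial.C c * w).eval t := by
    funext t
    have h := congrFun (iteratedDeriv_polynomial_eval ((Polynomial.X ^ 2 - 1) ^ m) m) t
    simp only [Polynomial.eval_pow, Polynomial.eval_sub, Polynomial.eval_X,
      Polynomial.eval_one] at h
    simp only [legendre, h, Polynomial.eval_mul, Polynomial.eval_C, hc, hw]
  set d : ℝ := 4 / (((m + 2 : ℕ) : ℝ) * (((m + 2 : ℕ) : ℝ) - 1)) with hd
  have jacobi_eq : (fun t : ℝ => d * (1 - t ^ 2) ^ 2 * iteratedDeriv 2 (legendre m) t)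
      = fun t => (Polynomial.C (d * c) * ((1 - Polynomial.X ^ 2) ^ 2 *
          Polynomial.derivative (Polynomial.derivative w))).eval t := by
    funext t
    rw [legendre_eq, iteratedDeriv_polynomial_eval, Polynomial.iterate_derivative_C_mul]
    simp
    ring
  have key := derivative_derivative_sq_mul_of_legendre (legendre_differential_equation (R := ℝ) m)
  rw [← hw] at key
  rw [jacobi_eq, iteratedDeriv_polynomial_eval, Polynomial.iterate_derivative_C_mul,
    Function.iterate_succ_apply, Function.iterate_one]
  rw [key, legendre_eq]
  have h1 : (m : ℝ) + 1 ≠ 0 := by positivity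
  have h2 : (m : ℝ) + 2 ≠ 0 := by positivity
  have hd' : d * ((m + 1) * (m + 2)) = 4 := by
    rw [hd]
    push_cast
    rw [show (m : ℝ) + 2 - 1 = m + 1 by ring]
    field_simp
  simp
  linear_combination ((m : ℝ) - 1) * m * c * w.eval s * hd'
end

section
/- Let x_{i-1} < x_i be reals, k ≥ 3 an integer, and u a twice continuously differentiable real function on [x_{i-1}, x_i]. Then there exists a unique polynomial p of degree ≤ k such that p(x_{i-1})=u(x_{i-1}), p(x_i)=u(x_i), p'(x_{i-1})=u'(x_{i-1}), p'(x_i)=u'(x_i), and ∫_{x_{i-1}}^{x_i} (u-p)''(x) q(x) dx = 0 for every polynomial q of degree ≤ k-2. (This is the well-definedness of the elementwise truncated Jacobi projection.) -/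
open Set Finset intervalIntegral

/-- The affine map sending `[-1,1]` onto `[p,q]`. -/
noncomputable def affMap (p q s : ℝ) : ℝ := (p + q) / 2 + s * (q - p) / 2

/-- `x 0 = a < x 1 < ... < x N = b` is a partition of `[a,b]`. -/
def IsMesh (a b : ℝ) (N : ℕ) (x : ℕ → ℝ) : Prop :=
  1 ≤ N ∧ x 0 = a ∧ x N = b ∧ ∀ i < N, x i < x (i + 1)

/-- `h` is the maximal element length `h = max_i (x i - x (i-1))`. -/
def IsMeshSize (N : ℕ) (x : ℕ → ℝ) (h : ℝ) : Prop :=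
  (∀ i ∈ Finset.Icc 1 N, x i - x (i - 1) ≤ h) ∧ ∃ i ∈ Finset.Icc 1 N, x i - x (i - 1) = h

/-- Quasi-uniformity with constant `c`: `h ≤ c · h_i` for all elements. -/
def IsQuasiUniform (N : ℕ) (x : ℕ → ℝ) (h c : ℝ) : Prop :=
  ∀ i ∈ Finset.Icc 1 N, h ≤ c * (x i - x (i - 1))

/-- `P i` are the element polynomials (degree ≤ k) of a member of `V_h^0`:
a C¹ piecewise polynomial vanishing at both ends of `[a,b]`. -/
def IsVh0 (k N : ℕ) (x : ℕ → ℝ) (P : ℕ → Polynomial ℝ) : Prop :=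
  (∀ i ∈ Finset.Icc 1 N, (P i).natDegree ≤ k) ∧
  (∀ i ∈ Finset.Icc 1 (N - 1), (P i).eval (x i) = (P (i + 1)).eval (x i)) ∧
  (∀ i ∈ Finset.Icc 1 (N - 1),
      (Polynomial.derivative (P i)).eval (x i) = (Polynomial.derivative (P (i + 1))).eval (x i)) ∧
  (P 1).eval (x 0) = 0 ∧ (P N).eval (x N) = 0

/-- `P i` are the element polynomials of a Petrov–Galerkin solution `u_h ∈ V_h^0`:
`∑_i ∫_{τ_i} (-α u_h'' + β u_h' + γ u_h) v_h = ∫_a^b f v_h` for all `v_h ∈ W_h`. -/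
def IsPGSol (k N : ℕ) (x : ℕ → ℝ) (α β γ : ℝ) (f : ℝ → ℝ) (P : ℕ → Polynomial ℝ) : Prop :=
  IsVh0 k N x P ∧
  ∀ Q : ℕ → Polynomial ℝ, (∀ i ∈ Finset.Icc 1 N, (Q i).natDegree ≤ k - 2) →
    (∑ i ∈ Finset.Icc 1 N, ∫ t in (x (i - 1))..(x i),
        (-α * ((Polynomial.derivative (Polynomial.derivative (P i))).eval t)
            + β * ((Polynomial.derivative (P i)).eval t) + γ * (P i).eval t) * (Q i).eval t)
      = ∑ i ∈ Finset.Icc 1 N, ∫ t in (x (i - 1))..(x i), f t * (Q i).eval t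

/-- `P i` are the element polynomials of a Gauss collocation solution `ū_h ∈ V_h^0`:
`(-α ū_h'' + β ū_h' + γ ū_h)(g) = f(g)` at every Gauss point `g` of every element. -/
def IsGaussSol (k N : ℕ) (x : ℕ → ℝ) (α β γ : ℝ) (f : ℝ → ℝ) (P : ℕ → Polynomial ℝ) : Prop :=
  IsVh0 k N x P ∧
  ∀ i ∈ Finset.Icc 1 N, ∀ s ∈ Set.Ioo (-1 : ℝ) 1, legendre (k - 1) s = 0 →
    -α * ((Polynomial.derivative (Polynomial.derivative (P i))).eval (affMap (x (i - 1)) (x i) s))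
        + β * ((Polynomial.derivative (P i)).eval (affMap (x (i - 1)) (x i) s))
        + γ * (P i).eval (affMap (x (i - 1)) (x i) s)
      = f (affMap (x (i - 1)) (x i) s)

/-- `p` is the elementwise truncated Jacobi projection of `u` on the element `[xl, xr]`:
the polynomial of degree ≤ k matching `u` and `u'` at both endpoints with
`(u - p)'' ⊥ P_{k-2}` in `L²(xl, xr)`. -/
def IsElemProj (k : ℕ) (u : ℝ → ℝ) (xl xr : ℝ) (p : Polynomial ℝ) : Prop :=
  p.natDegree ≤ k ∧ p.eval xl = u xl ∧ p.eval xr = u xr ∧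
  (Polynomial.derivative p).eval xl = deriv u xl ∧
  (Polynomial.derivative p).eval xr = deriv u xr ∧
  ∀ q : Polynomial ℝ, q.natDegree ≤ k - 2 →
    (∫ t in xl..xr,
        (iteratedDeriv 2 u t - (Polynomial.derivative (Polynomial.derivative p)).eval t)
          * q.eval t) = 0

/-- The `L²(a, b)` pairing of real polynomials. -/
noncomputable def polyPairing (a b : ℝ) :
    Polynomial ℝ →ₗ[ℝ] Polynomial ℝ →ₗ[ℝ] ℝ :=
  LinearMap.mk₂ ℝ (fun p q => ∫ t in a..b, p.eval t * q.eval t)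
    (fun p p' q => by
      simp only [Polynomial.eval_add, add_mul]
      exact integral_add (Continuous.intervalIntegrable (by fun_prop) _ _)
        (Continuous.intervalIntegrable (by fun_prop) _ _))
    (fun c p q => by
      simp only [Polynomial.eval_smul, smul_eq_mul, mul_assoc, integral_const_mul])
    (fun p q q' => by
      simp only [Polynomial.eval_add, mul_add]
      exact integral_add (Continuous.intervalIntegrable (by fun_prop) _ _)
        (Continuous.intervalIntegrable (by fun_prop) _ _))
    (fun c p q => by
      simp only [Polynomial.eval_smul, smul_eq_mul, mul_left_comm _ c, integral_const_mul])

theorem polyPairing_apply (a b : ℝ) (p q : Polynomial ℝ) :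
    polyPairing a b p q = ∫ t in a..b, p.eval t * q.eval t := rfl

theorem eq_zero_of_polyPairing_self {a b : ℝ} (hab : a < b) {p : Polynomial ℝ}
    (h : polyPairing a b p p = 0) : p = 0 := by
  by_contra hp
  obtain ⟨t, ht, hpt⟩ : ∃ t ∈ Set.Icc a b, p.eval t ≠ 0 := by
    by_contra! hzero
    exact hp (p.eq_zero_of_infinite_isRoot ((Set.Icc_infinite hab).mono hzero))
  refine (integral_pos hab (f := fun t => p.eval t * p.eval t) (by fun_prop)
    (fun _ _ => mul_self_nonneg _) ⟨t, ht, mul_self_pos.2 hpt⟩).ne' h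

/-- Integration against `f` as a linear functional on polynomials. -/
noncomputable def polyMoment (a b : ℝ) (f : ℝ → ℝ) (hf : Continuous f) : Polynomial ℝ →ₗ[ℝ] ℝ where
  toFun q := ∫ t in a..b, f t * q.eval t
  map_add' p q := by
    simp only [Polynomial.eval_add, mul_add]
    exact integral_add (Continuous.intervalIntegrable (by fun_prop) _ _)
      (Continuous.intervalIntegrable (by fun_prop) _ _)
  map_smul' c p := by
    simp only [Polynomial.eval_smul, smul_eq_mul, mul_left_comm _ c, integral_const_mul,
      RingHom.id_apply]

theorem polynomial_mem_degreeLT_succ {n : ℕ} {p : Polynomial ℝ} :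
    p ∈ Polynomial.degreeLT ℝ (n + 1) ↔ p.natDegree ≤ n := by
  rw [Polynomial.degreeLT_succ_eq_degreeLE, Polynomial.mem_degreeLE,
    Polynomial.natDegree_le_iff_degree_le]

theorem natDegree_derivative_derivative_le {n : ℕ} {p : Polynomial ℝ} (hp : p.natDegree ≤ n + 2) :
    (Polynomial.derivative (Polynomial.derivative p)).natDegree ≤ n := by
  have h₁ := Polynomial.natDegree_derivative_le p
  have h₂ := Polynomial.natDegree_derivative_le (Polynomial.derivative p)
  omega

theorem eq_zero_of_derivative_eq_zero_of_eval_eq_zero {p : Polynomial ℝ} {a : ℝ}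
    (h : Polynomial.derivative p = 0) (ha : p.eval a = 0) : p = 0 := by
  rw [Polynomial.eq_C_of_derivative_eq_zero h] at ha ⊢
  simpa using ha

/-- The initial value, the initial slope, and the moments of the second derivative against
polynomials of degree at most `n`. -/
noncomputable def initialDataMoments (a b : ℝ) (n : ℕ) :
    Polynomial.degreeLT ℝ (n + 3) →ₗ[ℝ]
      ℝ × ℝ × Module.Dual ℝ (Polynomial.degreeLT ℝ (n + 1)) :=
  (LinearMap.prod (Polynomial.leval a)
    (LinearMap.prod (Polynomial.leval a ∘ₗ Polynomial.derivative)
      ((Polynomial.degreeLT ℝ (n + 1)).dualRestrict ∘ₗ polyPairing a b ∘ₗ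
        Polynomial.derivative ∘ₗ Polynomial.derivative))) ∘ₗ
    (Polynomial.degreeLT ℝ (n + 3)).subtype

theorem initialDataMoments_injective {a b : ℝ} (hab : a < b) (n : ℕ) :
    Function.Injective (initialDataMoments a b n) := by
  rw [injective_iff_map_eq_zero]
  rintro ⟨p, hp⟩ h
  obtain ⟨h₀, h₁, h₂⟩ : p.eval a = 0 ∧ (Polynomial.derivative p).eval a = 0 ∧
      (Polynomial.degreeLT ℝ (n + 1)).dualRestrict
        (polyPairing a b (Polynomial.derivative (Polynomial.derivative p))) = 0 := by
    simpa [initialDataMoments] using h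
  have hmem := polynomial_mem_degreeLT_succ.2
    (natDegree_derivative_derivative_le (polynomial_mem_degreeLT_succ.1 hp))
  have hdd := eq_zero_of_polyPairing_self hab (LinearMap.congr_fun h₂ ⟨_, hmem⟩)
  exact Subtype.ext (eq_zero_of_derivative_eq_zero_of_eval_eq_zero
    (eq_zero_of_derivative_eq_zero_of_eval_eq_zero hdd h₁) h₀)

theorem initialDataMoments_bijective {a b : ℝ} (hab : a < b) (n : ℕ) :
    Function.Bijective (initialDataMoments a b n) := by
  have hfin (m : ℕ) : Module.Finite ℝ (Polynomial.degreeLT ℝ m) :=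
    Module.Finite.equiv (Polynomial.degreeLTEquiv ℝ m).symm
  have hrank (m : ℕ) : Module.finrank ℝ (Polynomial.degreeLT ℝ m) = m := by
    simp [(Polynomial.degreeLTEquiv ℝ m).finrank_eq]
  refine ⟨initialDataMoments_injective hab n,
    (LinearMap.injective_iff_surjective_of_finrank_eq_finrank ?_).1
      (initialDataMoments_injective hab n)⟩
  simp only [Module.finrank_prod, Subspace.dual_finrank_eq, hrank, Module.finrank_self]
  omega

/-- A function whose second derivative has vanishing zeroth and first moments, and whose value and
slope vanish at the left endpoint, has vanishing value and slope at the right endpoint. -/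
theorem right_endpoint_eq_zero_of_moments {a b : ℝ} {w w' w'' : ℝ → ℝ}
    (hw : ∀ t, HasDerivAt w (w' t) t) (hw' : ∀ t, HasDerivAt w' (w'' t) t)
    (hcont : Continuous w'') (h₀ : w a = 0) (h₁ : w' a = 0)
    (hm₀ : ∫ t in a..b, w'' t = 0) (hm₁ : ∫ t in a..b, w'' t * (b - t) = 0) :
    w b = 0 ∧ w' b = 0 := by
  have hcont' : Continuous w' := continuous_iff_continuousAt.2 fun t => (hw' t).continuousAt
  constructor
  · have hderiv (t : ℝ) : HasDerivAt (fun t => w' t * (b - t) + w t) (w'' t * (b - t)) t := by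
      exact (((hw' t).mul ((hasDerivAt_id t).const_sub b)).add (hw t)).congr_deriv (by simp)
    rw [integral_eq_sub_of_hasDerivAt (fun t _ => hderiv t)
      (Continuous.intervalIntegrable (by fun_prop) _ _)] at hm₁
    simpa [h₀, h₁] using hm₁
  · rw [integral_eq_sub_of_hasDerivAt (fun t _ => hw' t) (hcont.intervalIntegrable _ _)] at hm₀
    simpa [h₁] using hm₀

theorem hasDerivAt_deriv_iteratedDeriv_two {u : ℝ → ℝ} (hu : ContDiff ℝ 2 u) (t : ℝ) :
    HasDerivAt (deriv u) (iteratedDeriv 2 u t) t := by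
  rw [iteratedDeriv_succ, iteratedDeriv_one]
  exact (hu.differentiable_deriv_two t).hasDerivAt

theorem isElemProj_iff {a b : ℝ} {n : ℕ} {u : ℝ → ℝ} (hu : ContDiff ℝ 2 u) (hn : 1 ≤ n)
    (p : Polynomial ℝ) :
    IsElemProj (n + 2) u a b p ↔
      ∃ hp : p ∈ Polynomial.degreeLT ℝ (n + 3), initialDataMoments a b n ⟨p, hp⟩ =
        (u a, deriv u a, (Polynomial.degreeLT ℝ (n + 1)).dualRestrict
          (polyMoment a b (iteratedDeriv 2 u) (hu.continuous_iteratedDeriv 2 le_rfl))) := by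
  have hc := hu.continuous_iteratedDeriv 2 le_rfl
  have hsub (q : Polynomial ℝ) :
      ∫ t in a..b, (iteratedDeriv 2 u t -
        (Polynomial.derivative (Polynomial.derivative p)).eval t) * q.eval t =
      polyMoment a b _ hc q -
        polyPairing a b (Polynomial.derivative (Polynomial.derivative p)) q := by
    simp only [sub_mul]
    exact integral_sub (Continuous.intervalIntegrable (by fun_prop) _ _)
      (Continuous.intervalIntegrable (by fun_prop) _ _)
  constructor
  · rintro ⟨hdeg, h₀, -, h₁, -, hq⟩
    refine ⟨polynomial_mem_degreeLT_succ.2 hdeg, Prod.ext h₀ (Prod.ext h₁ ?_)⟩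
    ext ⟨q, hqmem⟩
    exact (sub_eq_zero.1 ((hsub q).symm.trans
      (hq q (polynomial_mem_degreeLT_succ.1 hqmem)))).symm
  · rintro ⟨hp, h⟩
    have h₀ : p.eval a = u a := congrArg Prod.fst h
    have h₁ : (Polynomial.derivative p).eval a = deriv u a := congrArg (fun z => z.2.1) h
    have hq (q : Polynomial ℝ) (hqdeg : q.natDegree ≤ n) :
        ∫ t in a..b, (iteratedDeriv 2 u t -
          (Polynomial.derivative (Polynomial.derivative p)).eval t) * q.eval t = 0 := by
      rw [hsub, sub_eq_zero]
      exact (LinearMap.congr_fun (congrArg (fun z => z.2.2) h)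
        ⟨q, polynomial_mem_degreeLT_succ.2 hqdeg⟩).symm
    have hdeg : (Polynomial.C b - Polynomial.X : Polynomial ℝ).natDegree ≤ n :=
      (Polynomial.natDegree_sub_le _ _).trans (by simpa using hn)
    obtain ⟨hb₀, hb₁⟩ := right_endpoint_eq_zero_of_moments (a := a) (b := b)
      (w := fun t => u t - p.eval t)
      (fun t => (hu.differentiable (by norm_num) t).hasDerivAt.sub (p.hasDerivAt t))
      (fun t => (hasDerivAt_deriv_iteratedDeriv_two hu t).sub
        ((Polynomial.derivative p).hasDerivAt t))
      (by fun_prop) (by simp [h₀]) (by simp [h₁])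
      (by simpa using hq 1 (by simp))
      (by simpa using hq (Polynomial.C b - Polynomial.X) hdeg)
    exact ⟨polynomial_mem_degreeLT_succ.1 hp, h₀, (sub_eq_zero.1 hb₀).symm, h₁,
      (sub_eq_zero.1 hb₁).symm, hq⟩

/-- Existence and uniqueness of the elementwise truncated Jacobi projection:
for `x_{i-1} < x_i`, `k ≥ 3` and `u` twice continuously differentiable, there is a unique
polynomial `p` of degree ≤ k with `p = u`, `p' = u'` at both endpoints and
`∫ (u - p)'' q = 0` for every polynomial `q` of degree ≤ k-2. -/
theorem truncated_jacobi_projection_exists_unique (xl xr : ℝ) (hx : xl < xr)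
    (k : ℕ) (hk : 3 ≤ k) (u : ℝ → ℝ) (hu : ContDiff ℝ 2 u) :
    ∃! p : Polynomial ℝ, IsElemProj k u xl xr p := by
  obtain ⟨n, rfl⟩ : ∃ n, k = n + 2 := ⟨k - 2, by omega⟩
  simp only [isElemProj_iff hu (show 1 ≤ n by omega)]
  obtain ⟨⟨p, hp⟩, h, huniq⟩ := (initialDataMoments_bijective hx n).existsUnique _
  exact ⟨p, ⟨hp, h⟩, fun p' ⟨hp', h'⟩ => congrArg Subtype.val (huniq ⟨p', hp'⟩ h')⟩
end

section
/- There exists a constant C depending only on k such that for every (k+2)-times continuously differentiable u on [a,b] and every element τ_i, the truncated Jacobi projection u_I satisfies (u-u_I)'(x_{i-1}) = (u-u_I)'(x_i) = 0 and |(u-u_I)'(gl_{in})| ≤ C h^{k+1} |u|_{k+2,∞,τ_i} at each of the k-2 interior Lobatto points gl_{in} of τ_i. -/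
open Set Finset intervalIntegral

open Polynomial in
/-- The Rodrigues polynomial `Dⁿ (X² - 1)ⁿ`, a nonzero multiple of the Legendre polynomial. -/
noncomputable def rodrigues (n : ℕ) : ℝ[X] := derivative^[n] ((X ^ 2 - 1) ^ n)

namespace Polynomial

theorem iteratedDeriv_eval (p : ℝ[X]) (n : ℕ) :
    iteratedDeriv n (fun t => p.eval t) = fun t => (derivative^[n] p).eval t := by
  induction n with
  | zero => simp
  | succ n ih =>
    rw [iteratedDeriv_succ, ih]
    funext t
    rw [Polynomial.deriv, Function.iterate_succ_apply']

theorem integral_eval_derivative (p : ℝ[X]) (a b : ℝ) :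
    ∫ t in a..b, (derivative p).eval t = p.eval b - p.eval a :=
  integral_eq_sub_of_hasDerivAt (fun t _ => p.hasDerivAt t)
    ((derivative p).continuous.intervalIntegrable _ _)

theorem eval_iterate_derivative_X_sq_sub_one_pow {n m : ℕ} (hm : m < n) {s : ℝ}
    (hs : s ^ 2 = 1) : (derivative^[m] ((X ^ 2 - 1 : ℝ[X]) ^ n)).eval s = 0 := by
  have hdvd : (X ^ 2 - 1 : ℝ[X]) ∣ derivative^[m] ((X ^ 2 - 1 : ℝ[X]) ^ n) :=
    (dvd_pow_self _ (Nat.sub_ne_zero_of_lt hm)).trans (pow_sub_dvd_iterate_derivative_pow _ n m)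
  exact eval_eq_zero_of_dvd_of_eval_eq_zero hdvd (by simp [hs])

theorem integral_iterate_derivative_mul_eq_zero {n m : ℕ} (hm : m ≤ n) {q : ℝ[X]}
    (hq : derivative^[m] q = 0) :
    ∫ t in (-1 : ℝ)..1, (derivative^[m] ((X ^ 2 - 1 : ℝ[X]) ^ n)).eval t * q.eval t = 0 := by
  induction m generalizing q with
  | zero => simp_all
  | succ m ih =>
    rw [Function.iterate_succ_apply] at hq
    have hparts := integral_deriv_mul_eq_sub (a := -1) (b := 1)
      (fun t _ => (derivative^[m] ((X ^ 2 - 1 : ℝ[X]) ^ n)).hasDerivAt t)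
      (fun t _ => q.hasDerivAt t) (Polynomial.continuous _ |>.intervalIntegrable _ _)
      (Polynomial.continuous _ |>.intervalIntegrable _ _)
    rw [intervalIntegral.integral_add (Continuous.intervalIntegrable (by fun_prop) _ _)
      (Continuous.intervalIntegrable (by fun_prop) _ _), ih (by lia) hq, add_zero,
      eval_iterate_derivative_X_sq_sub_one_pow (by lia) (by norm_num),
      eval_iterate_derivative_X_sq_sub_one_pow (by lia) (by norm_num)] at hparts
    simpa [Function.iterate_succ_apply'] using hparts

theorem integral_rodrigues_mul_eq_zero {n : ℕ} {q : ℝ[X]} (hq : q.natDegree < n) :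
    ∫ t in (-1 : ℝ)..1, (rodrigues n).eval t * q.eval t = 0 :=
  integral_iterate_derivative_mul_eq_zero le_rfl (iterate_derivative_eq_zero hq)

/-- The differential equations satisfied by the iterated derivatives of `(X² - 1) ^ N`. -/
theorem X_sq_sub_one_mul_iterate_derivative (N m : ℕ) :
    (X ^ 2 - 1) * derivative^[m + 2] ((X ^ 2 - 1 : ℝ[X]) ^ N) =
      C (2 * N - 2 - 2 * m : ℝ) * X * derivative^[m + 1] ((X ^ 2 - 1 : ℝ[X]) ^ N) +
        C ((m + 1) * (2 * N - m) : ℝ) * derivative^[m] ((X ^ 2 - 1 : ℝ[X]) ^ N) := by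
  induction m with
  | zero =>
    have hode : (X ^ 2 - 1) * derivative ((X ^ 2 - 1 : ℝ[X]) ^ N) =
        C (2 * N : ℝ) * X * (X ^ 2 - 1) ^ N := by
      cases N with
      | zero => simp
      | succ N =>
        simp only [derivative_pow, derivative_sub, derivative_X, derivative_one, map_mul,
          map_natCast, map_ofNat, Nat.add_sub_cancel]
        push_cast
        ring
    have hdiff := congrArg derivative hode
    simp only [derivative_mul, derivative_sub, derivative_X_pow, derivative_one, derivative_C,
      derivative_X] at hdiff
    simp only [Function.iterate_succ_apply', Function.iterate_zero_apply]
    simp only [map_mul, map_sub, map_natCast, map_ofNat, map_add, map_one] at hdiff ⊢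
    push_cast at hdiff ⊢
    linear_combination hdiff
  | succ m ih =>
    have hdiff := congrArg derivative ih
    simp only [derivative_mul, derivative_sub, derivative_X_pow, derivative_one, derivative_C,
      derivative_X, derivative_add, ← Function.iterate_succ_apply' derivative] at hdiff
    simp only [map_mul, map_sub, map_natCast, map_ofNat, map_add, map_one] at hdiff ⊢
    push_cast at hdiff ⊢
    simp only [show m + 1 + 2 = (m + 2).succ from rfl,
      show m + 1 + 1 = (m + 1).succ from rfl] at hdiff ⊢
    linear_combination hdiff

theorem natDegree_rodrigues_le (n : ℕ) : (rodrigues n).natDegree ≤ n := by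
  have hW : ((X ^ 2 - 1 : ℝ[X]) ^ n).natDegree ≤ n * 2 :=
    natDegree_pow_le_of_le n (by compute_degree)
  exact (natDegree_iterate_derivative _ n).trans (by lia)

theorem coeff_rodrigues_ne_zero (n : ℕ) : (rodrigues n).coeff n ≠ 0 := by
  have hmonic : ((X ^ 2 - 1 : ℝ[X]) ^ n).Monic :=
    (monic_X_pow_sub_C (1 : ℝ) two_ne_zero).pow n
  have hdeg : ((X ^ 2 - 1 : ℝ[X]) ^ n).natDegree = n + n := by
    rw [natDegree_pow, ← C_1, natDegree_X_pow_sub_C]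
    ring
  have hcoeff : ((X ^ 2 - 1 : ℝ[X]) ^ n).coeff (n + n) = 1 := hdeg ▸ hmonic.coeff_natDegree
  rw [rodrigues, coeff_iterate_derivative, hcoeff, nsmul_one, Nat.cast_ne_zero, Ne,
    Nat.descFactorial_eq_zero_iff_lt]
  lia

theorem exists_eq_C_mul_rodrigues_add {n : ℕ} (hn : n ≠ 0) {T : ℝ[X]} (hT : T.natDegree ≤ n) :
    ∃ (c : ℝ) (r : ℝ[X]), r.natDegree < n ∧ T = C c * rodrigues n + r := by
  set c := T.coeff n / (rodrigues n).coeff n with hc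
  refine ⟨c, T - C c * rodrigues n, ?_, by ring⟩
  have hle : (T - C c * rodrigues n).natDegree ≤ n :=
    (natDegree_sub_le_of_le hT ((natDegree_C_mul_le _ _).trans (natDegree_rodrigues_le n))).trans
      (max_self n).le
  refine lt_of_le_of_ne hle fun heq => hn ?_
  have hzero : (T - C c * rodrigues n).coeff n = 0 := by
    rw [coeff_sub, coeff_C_mul, hc, div_mul_cancel₀ _ (coeff_rodrigues_ne_zero n), sub_self]
  have : T - C c * rodrigues n = 0 := leadingCoeff_eq_zero.mp (by rw [leadingCoeff, heq, hzero])
  rw [← heq, this, natDegree_zero]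

/-- Taylor's theorem with a polynomial independent of the evaluation point. -/
theorem exists_natDegree_le_forall_abs_sub_eval_le {n : ℕ} {f : ℝ → ℝ}
    (hf : ContDiff ℝ (n + 1) f) {a b M : ℝ} (hab : a < b)
    (hM : ∀ y ∈ Set.Ioo a b, |iteratedDeriv (n + 1) f y| ≤ M) :
    ∃ T : ℝ[X], T.natDegree ≤ n ∧
      ∀ y ∈ Set.Icc a b, |f y - T.eval y| ≤ M * (b - a) ^ (n + 1) := by
  have hM0 : 0 ≤ M := (abs_nonneg _).trans (hM ((a + b) / 2) ⟨by linarith, by linarith⟩)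
  set T : ℝ[X] := ∑ j ∈ Finset.range (n + 1),
    C ((j.factorial : ℝ)⁻¹ * iteratedDeriv j f a) * (X - C a) ^ j with hT
  have heval (y : ℝ) : T.eval y = ∑ j ∈ Finset.range (n + 1),
      (j.factorial : ℝ)⁻¹ * iteratedDeriv j f a * (y - a) ^ j := by
    simp [hT, eval_finsetSum]
  refine ⟨T, natDegree_sum_le_of_forall_le _ _ fun j hj => ?_, fun y hy => ?_⟩
  · refine (natDegree_C_mul_le _ _).trans ((natDegree_pow_le_of_le j
      (natDegree_X_sub_C_le a)).trans ?_)
    have := Finset.mem_range.mp hj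
    lia
  rcases hy.1.eq_or_lt with rfl | hay
  · rw [heval, Finset.sum_range_succ']
    simpa using mul_nonneg hM0 (by positivity [sub_nonneg.2 hab.le])
  obtain ⟨z, hz, hrem⟩ := taylor_mean_remainder_lagrange_iteratedDeriv hay.ne
    (n := n) hf.contDiffOn
  rw [uIoo_of_lt hay] at hz
  have htaylor : taylorWithinEval f n (Set.uIcc a y) a y = T.eval y := by
    rw [taylor_within_apply, heval]
    refine Finset.sum_congr rfl fun j hj => ?_
    rw [iteratedDerivWithin_eq_iteratedDeriv (uniqueDiffOn_uIcc hay.ne)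
      (hf.contDiffAt.of_le ?_) Set.left_mem_uIcc, smul_eq_mul]
    · ring
    · have := Finset.mem_range.mp hj
      exact_mod_cast this.le
  have hfac : (1 : ℝ) ≤ (n + 1).factorial := by exact_mod_cast Nat.factorial_pos _
  rw [← htaylor, hrem, abs_div, abs_mul, abs_of_nonneg (pow_nonneg (sub_nonneg.2 hay.le) _),
    abs_of_pos (by linarith : (0 : ℝ) < (n + 1).factorial)]
  refine (div_le_self (mul_nonneg (abs_nonneg _)
    (pow_nonneg (sub_nonneg.2 hay.le) _)) hfac).trans ?_
  exact mul_le_mul (hM z ⟨hz.1, hz.2.trans_le hy.2⟩)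
    (pow_le_pow_left₀ (sub_nonneg.2 hay.le) (by linarith [hy.2]) _)
    (pow_nonneg (sub_nonneg.2 hay.le) _) hM0

end Polynomial

open Polynomial

theorem legendre_eq_eval_rodrigues (n : ℕ) :
    legendre n = fun s => (1 / ((2 : ℝ) ^ n * n.factorial)) * (rodrigues n).eval s := by
  funext s
  have hW : (fun t : ℝ => (t ^ 2 - 1) ^ n) = fun t => ((X ^ 2 - 1 : ℝ[X]) ^ n).eval t := by
    simp
  rw [legendre, hW, Polynomial.iteratedDeriv_eval, rodrigues]

/-- The primitive of the Legendre polynomial vanishes at the Lobatto points. -/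
theorem integral_rodrigues_eq_zero {n : ℕ} (hn : n ≠ 0) {s : ℝ}
    (hs : deriv (legendre n) s = 0) : ∫ t in (-1 : ℝ)..s, (rodrigues n).eval t = 0 := by
  obtain ⟨m, rfl⟩ := Nat.exists_eq_succ_of_ne_zero hn
  rw [legendre_eq_eval_rodrigues, deriv_const_mul_field, Polynomial.deriv] at hs
  have hroot : (derivative^[m + 2] ((X ^ 2 - 1 : ℝ[X]) ^ (m + 1))).eval s = 0 := by
    rw [Function.iterate_succ_apply']
    exact (mul_eq_zero.mp hs).resolve_left (by positivity)
  have hode := congrArg (eval s) (X_sq_sub_one_mul_iterate_derivative (m + 1) m)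
  have hcoeff : (2 * (m + 1 : ℕ) - 2 - 2 * m : ℝ) = 0 := by push_cast; ring
  rw [eval_mul, hroot, hcoeff, map_zero, zero_mul, zero_mul, zero_add, eval_mul, eval_C,
    mul_zero] at hode
  have hne : ((m + 1) * (2 * (m + 1 : ℕ) - m) : ℝ) ≠ 0 := by
    push_cast
    have : (0 : ℝ) ≤ m := m.cast_nonneg
    exact mul_ne_zero (by linarith) (by linarith)
  rw [rodrigues, Function.iterate_succ_apply', integral_eval_derivative,
    (mul_eq_zero.mp hode.symm).resolve_left hne,
    eval_iterate_derivative_X_sq_sub_one_pow m.lt_succ_self (by norm_num), sub_zero]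

/-- If `g` is orthogonal to `r` and close to `r`, its primitive is small. -/
theorem abs_integral_le_of_integral_mul_eq_zero {g r : ℝ → ℝ} (hg : Continuous g)
    (hr : Continuous r) {A s : ℝ} (hA : ∀ t ∈ Set.Icc (-1 : ℝ) 1, |g t - r t| ≤ A)
    (horth : ∫ t in (-1 : ℝ)..1, g t * r t = 0) (hs : s ∈ Set.Icc (-1 : ℝ) 1) :
    |∫ t in (-1 : ℝ)..s, g t| ≤ 2 * A := by
  have hsq : ∫ t in (-1 : ℝ)..1, g t ^ 2 ≤ 2 * A ^ 2 := by
    have hmono : ∫ t in (-1 : ℝ)..1, (g t ^ 2 - 2 * (g t * r t)) ≤ ∫ _ in (-1 : ℝ)..1, A ^ 2 := by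
      refine integral_mono_on (by norm_num) (Continuous.intervalIntegrable (by fun_prop) _ _)
        (Continuous.intervalIntegrable (by fun_prop) _ _) fun t ht => ?_
      have := sq_le_sq' (by linarith [abs_le.mp (hA t ht)]) (abs_le.mp (hA t ht)).2
      nlinarith [sq_nonneg (r t)]
    rw [integral_sub (Continuous.intervalIntegrable (by fun_prop) _ _)
      (Continuous.intervalIntegrable (by fun_prop) _ _), integral_const_mul, horth,
      intervalIntegral.integral_const, smul_eq_mul] at hmono
    linarith
  have habs : |∫ t in (-1 : ℝ)..s, g t| ≤ ∫ t in (-1 : ℝ)..1, |g t| :=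
    (abs_integral_le_integral_abs hs.1).trans (integral_mono_interval le_rfl hs.1 hs.2
      (Filter.Eventually.of_forall fun t => abs_nonneg (g t))
      (Continuous.intervalIntegrable (by fun_prop) _ _))
  refine habs.trans (le_of_forall_gt_imp_ge_of_dense fun B hB => ?_)
  have hA0 : 0 ≤ A := (abs_nonneg _).trans (hA 0 (by norm_num))
  have hAM : ∫ t in (-1 : ℝ)..1, B * |g t| ≤ ∫ t in (-1 : ℝ)..1, (g t ^ 2 + (B / 2) ^ 2) := by
    refine integral_mono_on (by norm_num) (Continuous.intervalIntegrable (by fun_prop) _ _)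
      (Continuous.intervalIntegrable (by fun_prop) _ _) fun t _ => ?_
    nlinarith [sq_nonneg (|g t| - B / 2), sq_abs (g t)]
  rw [integral_add (Continuous.intervalIntegrable (by fun_prop) _ _)
    (Continuous.intervalIntegrable (by fun_prop) _ _), integral_const_mul,
    intervalIntegral.integral_const, smul_eq_mul] at hAM
  have hB0 : 0 < B := by linarith
  refine le_of_mul_le_mul_left (hAM.trans ?_) hB0
  nlinarith

/-- Reference-element estimate: the primitive of a function orthogonal to polynomials of degree
less than `n` is controlled at Lobatto points by the distance to polynomials of degree `n`. -/
theorem abs_integral_le_of_orthogonal {n : ℕ} (hn : n ≠ 0) {f : ℝ → ℝ} (hf : Continuous f)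
    (horth : ∀ q : ℝ[X], q.natDegree < n → ∫ t in (-1 : ℝ)..1, f t * q.eval t = 0)
    {T : ℝ[X]} (hT : T.natDegree ≤ n) {A : ℝ}
    (hA : ∀ t ∈ Set.Icc (-1 : ℝ) 1, |f t - T.eval t| ≤ A) {s : ℝ}
    (hs : s ∈ Set.Icc (-1 : ℝ) 1) (hroot : deriv (legendre n) s = 0) :
    |∫ t in (-1 : ℝ)..s, f t| ≤ 2 * A := by
  obtain ⟨c, r, hr, rfl⟩ := exists_eq_C_mul_rodrigues_add hn hT
  have hint : ∫ t in (-1 : ℝ)..s, (f t - c * (rodrigues n).eval t) = ∫ t in (-1 : ℝ)..s, f t := by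
    rw [integral_sub (Continuous.intervalIntegrable (by fun_prop) _ _)
      (Continuous.intervalIntegrable (by fun_prop) _ _), integral_const_mul,
      integral_rodrigues_eq_zero hn hroot, mul_zero, sub_zero]
  rw [← hint]
  refine abs_integral_le_of_integral_mul_eq_zero (r := fun t => r.eval t) (by fun_prop)
    (by fun_prop) (fun t ht => ?_) ?_ hs
  · simpa [sub_sub] using hA t ht
  · simp_rw [sub_mul, mul_assoc]
    rw [integral_sub (Continuous.intervalIntegrable (by fun_prop) _ _)
      (Continuous.intervalIntegrable (by fun_prop) _ _), integral_const_mul, horth r hr,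
      integral_rodrigues_mul_eq_zero hr, mul_zero, sub_zero]

theorem integral_comp_affMap {a b : ℝ} (hab : a < b) (f : ℝ → ℝ) :
    ∫ t in (-1 : ℝ)..1, f (affMap a b t) = ((b - a) / 2)⁻¹ * ∫ y in a..b, f y := by
  have haff (t : ℝ) : affMap a b t = (b - a) / 2 * t + (a + b) / 2 := by
    rw [affMap]; ring
  simp_rw [haff]
  rw [integral_comp_mul_add _ (by linarith : (b - a) / 2 ≠ 0), smul_eq_mul]
  congr 2 <;> ring

/-- A function whose derivative is orthogonal to polynomials of degree less than `n` and which
vanishes at the left endpoint is small at the Lobatto points of `[a, b]`. -/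
theorem abs_le_of_deriv_orthogonal {n : ℕ} (hn : n ≠ 0) {a b : ℝ} (hab : a < b) {e e' : ℝ → ℝ}
    (hderiv : ∀ y, HasDerivAt e (e' y) y) (hcont : Continuous e') (hea : e a = 0)
    (horth : ∀ q : ℝ[X], q.natDegree < n → ∫ t in a..b, e' t * q.eval t = 0)
    {T : ℝ[X]} (hT : T.natDegree ≤ n) {A : ℝ}
    (hA : ∀ y ∈ Set.Icc a b, |e' y - T.eval y| ≤ A) {s : ℝ}
    (hs : s ∈ Set.Icc (-1 : ℝ) 1) (hroot : deriv (legendre n) s = 0) :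
    |e (affMap a b s)| ≤ (b - a) * A := by
  have hlen : 0 < (b - a) / 2 := by linarith
  have haff : Continuous (affMap a b) := by unfold affMap; fun_prop
  have hmem {t : ℝ} (ht : t ∈ Set.Icc (-1 : ℝ) 1) : affMap a b t ∈ Set.Icc a b := by
    rw [affMap]
    constructor <;> nlinarith [ht.1, ht.2]
  set L : ℝ[X] := C ((b - a) / 2) * X + C ((a + b) / 2) with hL
  set L' : ℝ[X] := C ((b - a) / 2)⁻¹ * X + C (-(((b - a) / 2)⁻¹ * ((a + b) / 2))) with hL'
  have hLeval (t : ℝ) : L.eval t = affMap a b t := by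
    simp [hL, affMap]; ring
  have hL'eval (t : ℝ) : L'.eval (affMap a b t) = t := by
    simp only [hL', affMap, eval_add, eval_mul, eval_C, eval_X]
    have : b - a ≠ 0 := by linarith
    field_simp
    ring
  have hcomp {q l : ℝ[X]} (hl : l.natDegree ≤ 1) : (q.comp l).natDegree ≤ q.natDegree := by
    rw [natDegree_comp]
    nlinarith
  have hbound := abs_integral_le_of_orthogonal (f := fun t => e' (affMap a b t)) hn (by fun_prop)
    (fun q hq => ?_) (T := T.comp L) ((hcomp natDegree_linear_le).trans hT) (A := A)
    (fun t ht => by simpa [hLeval] using hA _ (hmem ht)) hs hroot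
  · have hFTC : ∫ t in (-1 : ℝ)..s, (b - a) / 2 * e' (affMap a b t) = e (affMap a b s) := by
      rw [integral_eq_sub_of_hasDerivAt (f := fun t => e (affMap a b t)) (fun t _ => ?_)
        (Continuous.intervalIntegrable (by fun_prop) _ _)]
      · rw [show affMap a b (-1) = a by rw [affMap]; ring, hea, sub_zero]
      · have haffd : HasDerivAt (affMap a b) ((b - a) / 2) t := by
          have := (((hasDerivAt_id t).mul_const (b - a)).div_const 2).const_add ((a + b) / 2)
          rwa [one_mul] at this
        rw [mul_comm]
        exact (hderiv _).comp t haffd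
    rw [← hFTC, integral_const_mul, abs_mul, abs_of_pos hlen]
    nlinarith
  · have hq' := integral_comp_affMap hab fun y => e' y * (q.comp L').eval y
    rw [horth _ ((hcomp natDegree_linear_le).trans_lt hq), mul_zero] at hq'
    simpa [hL'eval] using hq'

/-- Superconvergence of the first derivative of the truncated Jacobi projection at the
interior Lobatto points (images of the roots of `L_{k-1}'`): `(u - u_I)'` vanishes at the
element endpoints and is `O(h^{k+1})` at the interior Lobatto points. -/
theorem truncated_jacobi_projection_superconvergence_lobatto_points (k : ℕ) (hk : 3 ≤ k) :
    ∃ C > 0, ∀ (a b : ℝ), a < b → ∀ (N : ℕ) (x : ℕ → ℝ) (h : ℝ),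
      IsMesh a b N x → IsMeshSize N x h →
      ∀ u : ℝ → ℝ, ContDiff ℝ (k + 2) u →
      ∀ p : ℕ → Polynomial ℝ, (∀ i ∈ Finset.Icc 1 N, IsElemProj k u (x (i - 1)) (x i) (p i)) →
      ∀ i ∈ Finset.Icc 1 N, ∀ M : ℝ,
        (∀ y ∈ Set.Ioo (x (i - 1)) (x i), |iteratedDeriv (k + 2) u y| ≤ M) →
        (deriv u (x (i - 1)) - (Polynomial.derivative (p i)).eval (x (i - 1)) = 0) ∧
        (deriv u (x i) - (Polynomial.derivative (p i)).eval (x i) = 0) ∧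
        ∀ s ∈ Set.Ioo (-1 : ℝ) 1, deriv (legendre (k - 1)) s = 0 →
          |deriv u (affMap (x (i - 1)) (x i) s)
              - (Polynomial.derivative (p i)).eval (affMap (x (i - 1)) (x i) s)|
            ≤ C * h ^ (k + 1) * M := by
  refine ⟨1, one_pos, fun a b _ N x h hmesh hsize u hu p hp i hi M hM => ?_⟩
  obtain ⟨hdeg, -, -, hl, hr, horth⟩ := hp i hi
  refine ⟨by rw [hl, sub_self], by rw [hr, sub_self], fun s hs hroot => ?_⟩
  have hi' := Finset.mem_Icc.mp hi
  have hlt : x (i - 1) < x i := by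
    have := hmesh.2.2.2 (i - 1) (by lia)
    rwa [Nat.sub_add_cancel hi'.1] at this
  have hM0 : 0 ≤ M := (abs_nonneg _).trans
    (hM ((x (i - 1) + x i) / 2) ⟨by linarith, by linarith⟩)
  obtain ⟨n, rfl⟩ : ∃ n, k = n + 1 := ⟨k - 1, by lia⟩
  have hu2 : ContDiff ℝ (n + 1) (iteratedDeriv 2 u) := by
    rw [iteratedDeriv_eq_iterate]
    exact_mod_cast ContDiff.iterate_deriv' (n + 1) 2 (f := u) (by exact_mod_cast hu)
  have hiter : iteratedDeriv (n + 1) (iteratedDeriv 2 u) = iteratedDeriv (n + 1 + 2) u := by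
    simp only [iteratedDeriv_eq_iterate, ← Function.iterate_add_apply]
  have hderiv (y : ℝ) : HasDerivAt (fun y => deriv u y - (derivative (p i)).eval y)
      (iteratedDeriv 2 u y - (derivative (derivative (p i))).eval y) y := by
    refine HasDerivAt.sub ?_ ((derivative (p i)).hasDerivAt y)
    rw [iteratedDeriv_succ, iteratedDeriv_one]
    have hdu : ContDiff ℝ (n + 2 : ℕ) (deriv u) :=
      ContDiff.iterate_deriv' (n + 2) 1 (by exact_mod_cast hu)
    exact (hdu.differentiable (by positivity) y).hasDerivAt
  obtain ⟨T, hT, hTu⟩ := Polynomial.exists_natDegree_le_forall_abs_sub_eval_le hu2 hlt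
    (hiter ▸ hM)
  have hpdeg : (derivative (derivative (p i))).natDegree ≤ n := by
    have h1 := natDegree_derivative_le (p i)
    have h2 := natDegree_derivative_le (derivative (p i))
    lia
  refine (abs_le_of_deriv_orthogonal (n := n) (by lia) hlt hderiv
    (hu2.continuous.sub (Polynomial.continuous _)) (by rw [hl, sub_self])
    (fun q hq => horth q (by lia)) (T := T - derivative (derivative (p i)))
    ((natDegree_sub_le_of_le hT hpdeg).trans (max_self n).le)
    (fun y hy => by simpa using hTu y hy) ⟨hs.1.le, hs.2.le⟩ hroot).trans ?_
  have hpow := pow_le_pow_left₀ (sub_nonneg.2 hlt.le) (hsize.1 i hi) (n + 1 + 1)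
  calc (x i - x (i - 1)) * (M * (x i - x (i - 1)) ^ (n + 1))
      = (x i - x (i - 1)) ^ (n + 1 + 1) * M := by ring
    _ ≤ h ^ (n + 1 + 1) * M := mul_le_mul_of_nonneg_right hpow hM0
    _ = 1 * h ^ (n + 1 + 1) * M := by rw [one_mul]
end

section
/- There exist constants C>0 and h_0>0, depending only on k, α, β, γ, b-a and the quasi-uniformity constant c, such that whenever h ≤ h_0, u is (k+1)-times continuously differentiable with u(a)=u(b)=0, f := -αu''+βu'+γu, and u_h is a Petrov–Galerkin solution, then ‖u-u_h‖_{0,∞} ≤ C h^{k+1} |u|_{k+1,∞}, ‖u-u_h‖_{1,∞} ≤ C h^{k} |u|_{k+1,∞}, and ‖u-u_h‖_2 ≤ C h^{k-1} |u|_{k+1,∞}. -/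
open Set Finset intervalIntegral

theorem nonneg_of_elliptic_pos {α β γ a b : ℝ} (hα : 0 < α) (hγ : 0 ≤ γ)
    {ψ ψ' ψ'' : ℝ → ℝ} (hψ : ∀ y, HasDerivAt ψ (ψ' y) y) (hψ' : ∀ y, HasDerivAt ψ' (ψ'' y) y)
    (hL : ∀ y ∈ Set.Icc a b, 0 < -α * ψ'' y + β * ψ' y + γ * ψ y)
    (ha : 0 ≤ ψ a) (hb : 0 ≤ ψ b) : ∀ y ∈ Set.Icc a b, 0 ≤ ψ y := by
  intro y hy
  have hcont : Continuous ψ := continuous_iff_continuousAt.2 fun t => (hψ t).continuousAt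
  obtain ⟨m, hm, hmin⟩ := isCompact_Icc.exists_isMinOn ⟨y, hy⟩ hcont.continuousOn
  refine le_trans ?_ (hmin hy)
  by_contra! hneg
  have hma : a < m := lt_of_le_of_ne hm.1 fun h => by subst h; linarith
  have hmb : m < b := lt_of_le_of_ne hm.2 fun h => by subst h; linarith
  have hloc : IsLocalMin ψ m := hmin.isLocalMin (Icc_mem_nhds hma hmb)
  have hd0 : ψ' m = 0 := hloc.hasDerivAt_eq_zero (hψ m)
  have hderiv : deriv ψ = ψ' := funext fun t => (hψ t).deriv
  have hlt : ψ'' m < 0 := by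
    have := hL m hm
    rw [hd0] at this
    nlinarith [mul_nonneg hγ (neg_nonneg.2 hneg.le)]
  have hmax : IsLocalMax ψ m := by
    apply isLocalMax_of_deriv_deriv_neg
    · rw [hderiv, (hψ' m).deriv]; exact hlt
    · rw [hderiv, hd0]
    · exact hcont.continuousAt
  have heq : ψ =ᶠ[nhds m] fun _ => ψ m := by
    filter_upwards [hloc, hmax] with t h1 h2 using le_antisymm h2 h1
  have h2 : deriv (deriv ψ) m = 0 := by
    rw [heq.deriv.deriv_eq]; simp
  rw [hderiv, (hψ' m).deriv] at h2
  linarith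

/-- A priori bound in the maximum norm for a two-point boundary value problem. -/
theorem exists_abs_le_of_elliptic_le (α β γ d : ℝ) (hα : 0 < α) (hγ : 0 ≤ γ) (hd : 0 < d) :
    ∃ K > 0, ∀ (a G : ℝ) (w w' w'' : ℝ → ℝ), 0 ≤ G → (∀ y, HasDerivAt w (w' y) y) →
      (∀ y, HasDerivAt w' (w'' y) y) → |w a| ≤ G → |w (a + d)| ≤ G →
      (∀ y ∈ Set.Icc a (a + d), |-α * w'' y + β * w' y + γ * w y| ≤ G) →
      ∀ y ∈ Set.Icc a (a + d), |w y| ≤ K * G := by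
  obtain ⟨μ, hμ1, hμ⟩ : ∃ μ : ℝ, 1 ≤ μ ∧ 1 ≤ α * μ - β := by
    refine ⟨1 + (1 + |β|) / α, by have := abs_nonneg β; have : 0 ≤ (1 + |β|) / α := by positivity
                                  linarith, ?_⟩
    have : α * (1 + (1 + |β|) / α) = α + (1 + |β|) := by field_simp
    linarith [le_abs_self β]
  refine ⟨Real.exp (μ * d) + 1, by positivity, ?_⟩
  intro a G w w' w'' hG hw hw' hwa hwb hL y hy
  have key : ∀ s : ℝ, |s| = 1 → ∀ δ > 0,
      0 ≤ (G + δ) * (Real.exp (μ * d) - Real.exp (μ * (y - a))) + G + s * w y := by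
    intro s hs δ hδ
    have hexp : ∀ t, HasDerivAt (fun t => Real.exp (μ * (t - a)))
        (μ * Real.exp (μ * (t - a))) t := fun t => by
      have := (((hasDerivAt_id t).sub_const a).const_mul μ).exp
      convert! this using 1
      simp; ring
    refine nonneg_of_elliptic_pos (α := α) (β := β) (γ := γ) (a := a) (b := a + d)
      (ψ := fun t => (G + δ) * (Real.exp (μ * d) - Real.exp (μ * (t - a))) + G + s * w t)
      (ψ' := fun t => (G + δ) * (-(μ * Real.exp (μ * (t - a)))) + s * w' t)
      (ψ'' := fun t => (G + δ) * (-(μ * (μ * Real.exp (μ * (t - a))))) + s * w'' t)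
      hα hγ ?_ ?_ ?_ ?_ ?_ y hy
    · intro t
      exact ((((hexp t).const_sub _).const_mul _).add_const _).add ((hw t).const_mul s)
    · intro t
      exact ((((hexp t).const_mul μ).neg).const_mul _).add ((hw' t).const_mul s)
    · intro t ht
      have h1 : |s * (-α * w'' t + β * w' t + γ * w t)| ≤ G := by
        rw [abs_mul, hs, one_mul]; exact hL t ht
      have h2 := (abs_le.1 h1).1
      have hE : 1 ≤ Real.exp (μ * (t - a)) :=
        Real.one_le_exp (mul_nonneg (by linarith) (by linarith [ht.1]))
      have hE2 : Real.exp (μ * (t - a)) ≤ Real.exp (μ * d) :=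
        Real.exp_le_exp.2 (mul_le_mul_of_nonneg_left (by linarith [ht.2]) (by linarith))
      set E := Real.exp (μ * (t - a))
      have h3 : 1 ≤ μ * (α * μ - β) * E := by
        have := one_le_mul_of_one_le_of_one_le hμ1 hμ
        exact one_le_mul_of_one_le_of_one_le this hE
      have h4 : (G + δ) * 1 ≤ (G + δ) * (μ * (α * μ - β) * E) :=
        mul_le_mul_of_nonneg_left h3 (by linarith)
      have h5 : 0 ≤ γ * ((G + δ) * (Real.exp (μ * d) - E) + G) :=
        mul_nonneg hγ (add_nonneg (mul_nonneg (by linarith) (by linarith)) hG)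
      linarith
    · have h1 : |s * w a| ≤ G := by rw [abs_mul, hs, one_mul]; exact hwa
      have h2 : 0 ≤ (G + δ) * (Real.exp (μ * d) - Real.exp (μ * (a - a))) :=
        mul_nonneg (by linarith) (sub_nonneg.2 (Real.exp_le_exp.2 (by
          rw [sub_self, mul_zero]; exact mul_nonneg (by linarith) hd.le)))
      linarith [(abs_le.1 h1).1]
    · have h1 : |s * w (a + d)| ≤ G := by rw [abs_mul, hs, one_mul]; exact hwb
      rw [add_sub_cancel_left, sub_self, mul_zero]
      linarith [(abs_le.1 h1).1]
  have hbd : ∀ s : ℝ, |s| = 1 → -(s * w y) ≤ (Real.exp (μ * d) + 1) * G := by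
    intro s hs
    refine le_of_forall_pos_le_add fun δ hδ => ?_
    have hEpos : 0 < Real.exp (μ * d) := Real.exp_pos _
    have hk := key s hs (δ / Real.exp (μ * d)) (by positivity)
    have h1 : (G + δ / Real.exp (μ * d)) * (Real.exp (μ * d) - Real.exp (μ * (y - a)))
        ≤ (G + δ / Real.exp (μ * d)) * Real.exp (μ * d) :=
      mul_le_mul_of_nonneg_left (by linarith [Real.exp_pos (μ * (y - a))]) (by positivity)
    have h2 : (G + δ / Real.exp (μ * d)) * Real.exp (μ * d) = G * Real.exp (μ * d) + δ := by
      field_simp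
    linarith
  have h1 := hbd 1 (by simp)
  have h2 := hbd (-1) (by simp)
  exact abs_le.2 ⟨by linarith, by linarith⟩

theorem exists_abs_deriv_le_of_elliptic_le (α β γ d : ℝ) (hα : 0 < α) (hγ : 0 ≤ γ)
    (hd : 0 < d) :
    ∃ K > 0, ∀ (a G : ℝ) (w w' w'' : ℝ → ℝ), 0 ≤ G → (∀ y, HasDerivAt w (w' y) y) →
      (∀ y, HasDerivAt w' (w'' y) y) → |w a| ≤ G → |w (a + d)| ≤ G →
      (∀ y ∈ Set.Icc a (a + d), |-α * w'' y + β * w' y + γ * w y| ≤ G) →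
      ∀ y ∈ Set.Icc a (a + d), |w y| ≤ K * G ∧ |w' y| ≤ K * G := by
  obtain ⟨K, hK, hKb⟩ := exists_abs_le_of_elliptic_le α β γ d hα hγ hd
  set κ : ℝ := β / α with hκ
  set X : ℝ := Real.exp (|κ| * d) with hX
  have hXpos : 0 < X := Real.exp_pos _
  set K' : ℝ := X * (X * (2 / d) + X * ((γ * K + 1) / α) * d) with hK'
  have hK'pos : 0 < K' := by positivity
  refine ⟨K + K', by positivity, ?_⟩
  intro a G w w' w'' hG hw hw' hwa hwb hL y hy
  have hwy := hKb a G w w' w'' hG hw hw' hwa hwb hL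
  refine ⟨(hwy y hy).trans (by nlinarith), ?_⟩
  obtain ⟨ξ, hξ, hξe⟩ := exists_hasDerivAt_eq_slope w w' (by linarith : a < a + d)
    (fun t _ => (hw t).continuousAt.continuousWithinAt) (fun t _ => hw t)
  have hξb : |w' ξ| ≤ 2 / d * G := by
    rw [hξe, add_sub_cancel_left, abs_div, abs_of_pos hd, div_le_iff₀ hd]
    have : 2 / d * G * d = 2 * G := by field_simp
    rw [this]
    exact (abs_sub _ _).trans (by linarith)
  have hexpb : ∀ t ∈ Set.Icc a (a + d), Real.exp (-κ * (t - a)) ≤ X ∧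
      Real.exp (κ * (t - a)) ≤ X := by
    intro t ht
    have h0 : 0 ≤ t - a := by linarith [ht.1]
    have h1 : |κ| * (t - a) ≤ |κ| * d :=
      mul_le_mul_of_nonneg_left (by linarith [ht.2]) (abs_nonneg κ)
    constructor
    · exact Real.exp_le_exp.2 ((mul_le_mul_of_nonneg_right (neg_le_abs κ) h0).trans h1)
    · exact Real.exp_le_exp.2 ((mul_le_mul_of_nonneg_right (le_abs_self κ) h0).trans h1)
  have hexp : ∀ t, HasDerivAt (fun t => Real.exp (-κ * (t - a)) * w' t)
      (Real.exp (-κ * (t - a)) * (w'' t - κ * w' t)) t := fun t => by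
    have := ((((hasDerivAt_id t).sub_const a).const_mul (-κ)).exp).mul (hw' t)
    convert! this using 1
    simp; ring
  have hbd : ∀ t ∈ Set.Icc a (a + d),
      ‖Real.exp (-κ * (t - a)) * (w'' t - κ * w' t)‖ ≤ X * ((γ * K + 1) / α) * G := by
    intro t ht
    rw [Real.norm_eq_abs, abs_mul, abs_of_pos (Real.exp_pos _), mul_assoc]
    refine mul_le_mul (hexpb t ht).1 ?_ (abs_nonneg _) hXpos.le
    have h1 : w'' t - κ * w' t
        = (γ * w t - (-α * w'' t + β * w' t + γ * w t)) / α := by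
      rw [hκ]; field_simp; ring
    rw [h1, abs_div, abs_of_pos hα, div_mul_eq_mul_div]
    refine div_le_div_of_nonneg_right ?_ hα.le
    refine (abs_sub _ _).trans ?_
    rw [abs_mul, abs_of_nonneg hγ]
    have := mul_le_mul_of_nonneg_left (hwy t ht) hγ
    linarith [hL t ht]
  have hmv := (convex_Icc a (a + d)).norm_image_sub_le_of_norm_hasDerivWithin_le
    (fun t ht => (hexp t).hasDerivWithinAt) hbd ⟨hξ.1.le, hξ.2.le⟩ hy
  have hyξ : ‖y - ξ‖ ≤ d := by
    rw [Real.norm_eq_abs, abs_le]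
    constructor <;> linarith [hy.1, hy.2, hξ.1, hξ.2]
  have h1 : |Real.exp (-κ * (y - a)) * w' y| ≤ X * (2 / d) * G + X * ((γ * K + 1) / α) * G * d := by
    have h2 : |Real.exp (-κ * (ξ - a)) * w' ξ| ≤ X * (2 / d * G) := by
      rw [abs_mul, abs_of_pos (Real.exp_pos _)]
      exact mul_le_mul (hexpb ξ ⟨hξ.1.le, hξ.2.le⟩).1 hξb (abs_nonneg _) hXpos.le
    have h3 : X * ((γ * K + 1) / α) * G * ‖y - ξ‖ ≤ X * ((γ * K + 1) / α) * G * d :=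
      mul_le_mul_of_nonneg_left hyξ (by positivity)
    have h4 := abs_sub_abs_le_abs_sub (Real.exp (-κ * (y - a)) * w' y)
      (Real.exp (-κ * (ξ - a)) * w' ξ)
    rw [Real.norm_eq_abs] at hmv
    linarith
  have h5 : w' y = Real.exp (κ * (y - a)) * (Real.exp (-κ * (y - a)) * w' y) := by
    rw [← mul_assoc, ← Real.exp_add]
    simp
  rw [h5, abs_mul, abs_of_pos (Real.exp_pos _)]
  have h6 := mul_le_mul (hexpb y hy).2 h1 (abs_nonneg _) hXpos.le
  refine h6.trans ?_
  have : X * (X * (2 / d) * G + X * ((γ * K + 1) / α) * G * d) = K' * G := by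
    rw [hK']; ring
  rw [this]
  nlinarith

/-- If the residual of a two-point boundary value problem has a small first and an even smaller
second primitive, then the solution inherits these two smallness orders. -/
theorem exists_abs_le_of_primitives_le (α β γ d : ℝ) (hα : 0 < α) (hγ : 0 ≤ γ) (hd : 0 < d) :
    ∃ K > 0, ∀ (a v₀ h ρ : ℝ) (ε v e r R T : ℝ → ℝ), 0 ≤ h → h ≤ 1 → 0 ≤ ρ →
      (∀ p q, IntervalIntegrable ε MeasureTheory.volume p q) →
      (∀ y, v y = v₀ + ∫ t in a..y, ε t) → (∀ y, e y = ∫ t in a..y, v t) →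
      (∀ y, r y = -α * ε y + β * v y + γ * e y) →
      (∀ y, R y = ∫ t in a..y, r t) → (∀ y, T y = ∫ t in a..y, R t) →
      (∀ y ∈ Set.Icc a (a + d), |R y| ≤ h * ρ) →
      (∀ y ∈ Set.Icc a (a + d), |T y| ≤ h ^ 2 * ρ) → e (a + d) = 0 →
      ∀ y ∈ Set.Icc a (a + d), |e y| ≤ K * (h ^ 2 * ρ) ∧ |v y| ≤ K * (h * ρ) := by
  obtain ⟨K, hK, hKb⟩ := exists_abs_deriv_le_of_elliptic_le α β γ d hα hγ hd
  set A : ℝ := 1 / α with hA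
  have hApos : 0 < A := by positivity
  set B : ℝ := β / α ^ 2 with hB
  set L : ℝ := A + |B| * d + |β * B + γ * A| + |γ * B| * d with hLdef
  have hLnn : 0 ≤ L := by positivity
  refine ⟨K * L + A + |B| * (d + 1), by positivity, ?_⟩
  intro a v₀ h ρ ε v e r R T hh hh1 hρ hε hv he hr hR hT hRb hTb hed
  have hvc : Continuous v := by
    rw [funext hv]
    exact continuous_const.add (intervalIntegral.continuous_primitive hε a)
  have hed' : ∀ y, HasDerivAt e (v y) y := fun y => by
    rw [funext he]; exact (hvc.integral_hasStrictDerivAt a y).hasDerivAt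
  have hec : Continuous e := continuous_iff_continuousAt.2 fun t => (hed' t).continuousAt
  have hri : ∀ p q, IntervalIntegrable r MeasureTheory.volume p q := fun p q => by
    rw [funext hr]
    exact (((hε p q).const_mul (-α)).add ((hvc.const_mul β).intervalIntegrable p q)).add
      ((hec.const_mul γ).intervalIntegrable p q)
  have hRc : Continuous R := by
    rw [funext hR]
    exact intervalIntegral.continuous_primitive hri a
  have hTd : ∀ y, HasDerivAt T (R y) y := fun y => by
    rw [funext hT]; exact (hRc.integral_hasStrictDerivAt a y).hasDerivAt
  have hTc : Continuous T := continuous_iff_continuousAt.2 fun t => (hTd t).continuousAt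
  set S : ℝ → ℝ := fun y => ∫ t in a..y, T t with hS
  have hSd : ∀ y, HasDerivAt S (T y) y := fun y =>
    (hTc.integral_hasStrictDerivAt a y).hasDerivAt
  have hSb : ∀ y ∈ Set.Icc a (a + d), |S y| ≤ d * (h ^ 2 * ρ) := by
    intro y hy
    have h1 : ‖∫ t in a..y, T t‖ ≤ h ^ 2 * ρ * |y - a| := by
      refine intervalIntegral.norm_integral_le_of_norm_le_const fun t ht => ?_
      rw [Set.uIoc_of_le hy.1] at ht
      exact hTb t ⟨ht.1.le, ht.2.trans hy.2⟩
    refine h1.trans ?_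
    rw [abs_of_nonneg (by linarith [hy.1]), mul_comm]
    exact mul_le_mul_of_nonneg_right (by linarith [hy.2]) (by positivity)
  have hvR : ∀ y, v y + A * R y = v₀ + ∫ t in a..y, A * (β * v t + γ * e t) := by
    intro y
    rw [hv y, hR y, ← intervalIntegral.integral_const_mul, add_assoc,
      ← intervalIntegral.integral_add (hε a y) ((hri a y).const_mul A)]
    congr 1
    refine intervalIntegral.integral_congr fun t _ => ?_
    simp only [hr t, hA]
    field_simp
    ring
  have hvRd : ∀ y, HasDerivAt (fun y => v y + A * R y) (A * (β * v y + γ * e y)) y := fun y => by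
    rw [funext hvR]
    exact (((((hvc.const_mul β).add (hec.const_mul γ)).const_mul A).integral_hasStrictDerivAt
      a y).hasDerivAt).const_add v₀
  have ha0 : e a = 0 ∧ T a = 0 ∧ S a = 0 := by simp [he, hT, hS]
  have hstep := hKb a (L * (h ^ 2 * ρ)) (fun y => e y + A * T y + B * S y)
    (fun y => v y + A * R y + B * T y) (fun y => A * (β * v y + γ * e y) + B * R y)
    (by positivity) (fun y => ((hed' y).add ((hTd y).const_mul A)).add ((hSd y).const_mul B))
    (fun y => (hvRd y).add ((hTd y).const_mul B))
    (by simp only [ha0.1, ha0.2.1, ha0.2.2]; simp; positivity)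
    (by
      have hmem : a + d ∈ Set.Icc a (a + d) := ⟨by linarith, le_rfl⟩
      simp only [hed, zero_add]
      refine (abs_add_le _ _).trans ?_
      rw [abs_mul, abs_mul, abs_of_pos hApos, hLdef]
      have h1 := mul_le_mul_of_nonneg_left (hTb _ hmem) hApos.le
      have h2 := mul_le_mul_of_nonneg_left (hSb _ hmem) (abs_nonneg B)
      have h3 : 0 ≤ (|β * B + γ * A| + |γ * B| * d) * (h ^ 2 * ρ) := by positivity
      linarith)
    (by
      intro y hy
      have h0 : -α * (A * (β * v y + γ * e y) + B * R y) + β * (v y + A * R y + B * T y)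
          + γ * (e y + A * T y + B * S y) = (β * B + γ * A) * T y + γ * B * S y := by
        simp only [hA, hB]; field_simp; ring
      rw [h0]
      refine (abs_add_le _ _).trans ?_
      rw [abs_mul, abs_mul, hLdef]
      have h1 := mul_le_mul_of_nonneg_left (hTb _ hy) (abs_nonneg (β * B + γ * A))
      have h2 := mul_le_mul_of_nonneg_left (hSb _ hy) (abs_nonneg (γ * B))
      have h3 : 0 ≤ (A + |B| * d) * (h ^ 2 * ρ) := by positivity
      linarith)
  intro y hy
  obtain ⟨h1, h2⟩ := hstep y hy
  have hhh : h ^ 2 * ρ ≤ h * ρ := mul_le_mul_of_nonneg_right (by nlinarith) hρ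
  have hAT : |A * T y| ≤ A * (h ^ 2 * ρ) := by
    rw [abs_mul, abs_of_pos hApos]; exact mul_le_mul_of_nonneg_left (hTb y hy) hApos.le
  have hAR : |A * R y| ≤ A * (h * ρ) := by
    rw [abs_mul, abs_of_pos hApos]; exact mul_le_mul_of_nonneg_left (hRb y hy) hApos.le
  have hBS : |B * S y| ≤ |B| * (d * (h ^ 2 * ρ)) := by
    rw [abs_mul]; exact mul_le_mul_of_nonneg_left (hSb y hy) (abs_nonneg B)
  have hBT : |B * T y| ≤ |B| * (h ^ 2 * ρ) := by
    rw [abs_mul]; exact mul_le_mul_of_nonneg_left (hTb y hy) (abs_nonneg B)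
  constructor
  · have h3 : e y = (e y + A * T y + B * S y) - A * T y - B * S y := by ring
    have h4 := (abs_sub (e y + A * T y + B * S y - A * T y) (B * S y)).trans
      (add_le_add_left (abs_sub (e y + A * T y + B * S y) (A * T y)) _)
    rw [← h3] at h4
    have h5 : 0 ≤ |B| * (h ^ 2 * ρ) := by positivity
    linarith
  · have h3 : v y = (v y + A * R y + B * T y) - A * R y - B * T y := by ring
    have h4 := (abs_sub (v y + A * R y + B * T y - A * R y) (B * T y)).trans
      (add_le_add_left (abs_sub (v y + A * R y + B * T y) (A * R y)) _)
    rw [← h3] at h4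
    have h5 : 0 ≤ |B| * d * (h * ρ) := by positivity
    have h6 : K * (L * (h ^ 2 * ρ)) ≤ K * (L * (h * ρ)) := by gcongr
    have h7 : |B| * (h ^ 2 * ρ) ≤ |B| * (h * ρ) := by gcongr
    linarith

theorem mesh_mono {N : ℕ} {x : ℕ → ℝ} (hx : ∀ i < N, x i < x (i + 1)) :
    ∀ j ≤ N, ∀ i ≤ j, x i ≤ x j := by
  intro j
  induction j with
  | zero => intro _ i hi; rw [Nat.le_zero.1 hi]
  | succ j ih =>
    intro hj i hi
    rcases Nat.lt_or_ge i (j + 1) with h | h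
    · exact (ih (by omega) i (by omega)).trans (hx j (by omega)).le
    · rw [le_antisymm hi h]

theorem exists_mem_element {x : ℕ → ℝ} {N : ℕ} (hN : 1 ≤ N) {y : ℝ} (h0 : x 0 ≤ y)
    (hyN : y ≤ x N) : ∃ i < N, y ∈ Set.Icc (x i) (x (i + 1)) := by
  induction N, hN using Nat.le_induction with
  | base => exact ⟨0, one_pos, h0, hyN⟩
  | succ n _ ih =>
    rcases le_total y (x n) with h | h
    · obtain ⟨i, hi, hiy⟩ := ih h
      exact ⟨i, by omega, hiy⟩
    · exact ⟨n, by omega, h, hyN⟩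

theorem eq_add_integral_of_hasDerivAt_pieces {N : ℕ} {x : ℕ → ℝ} (hx : ∀ i < N, x i < x (i + 1))
    {F f : ℕ → ℝ → ℝ} {φ : ℝ → ℝ} (hφi : ∀ p q, IntervalIntegrable φ MeasureTheory.volume p q)
    (hF : ∀ i < N, ∀ t, HasDerivAt (F i) (f i t) t)
    (hφ : ∀ i < N, ∀ t ∈ Set.Ioc (x i) (x (i + 1)), φ t = f i t)
    (hglue : ∀ i, i + 1 < N → F i (x (i + 1)) = F (i + 1) (x (i + 1))) :
    ∀ i < N, ∀ y ∈ Set.Icc (x i) (x (i + 1)), F 0 (x 0) + ∫ t in (x 0)..y, φ t = F i y := by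
  have hstep : ∀ i < N, ∀ y ∈ Set.Icc (x i) (x (i + 1)), ∫ t in (x i)..y, φ t
      = F i y - F i (x i) := by
    intro i hi y hy
    have heq : ∀ t ∈ Set.Ioc (x i) y, φ t = f i t := fun t ht =>
      hφ i hi t ⟨ht.1, ht.2.trans hy.2⟩
    have hcongr : ∫ t in (x i)..y, φ t = ∫ t in (x i)..y, f i t := by
      refine intervalIntegral.integral_congr_uIoo fun t ht => ?_
      rw [Set.uIoo_of_le hy.1] at ht
      exact heq t ⟨ht.1, ht.2.le⟩
    rw [hcongr]
    refine intervalIntegral.integral_eq_sub_of_hasDerivAt (fun t _ => hF i hi t) ?_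
    refine (hφi (x i) y).congr fun t ht => ?_
    rw [Set.uIoc_of_le hy.1] at ht
    exact heq t ht
  have hnode : ∀ i < N, F 0 (x 0) + ∫ t in (x 0)..(x i), φ t = F i (x i) := by
    intro i
    induction i with
    | zero => intro _; simp
    | succ i ih =>
      intro hi
      rw [← intervalIntegral.integral_add_adjacent_intervals (hφi (x 0) (x i))
        (hφi (x i) (x (i + 1))), ← add_assoc, ih (by omega),
        hstep i (by omega) _ ⟨(hx i (by omega)).le, le_rfl⟩, add_sub_cancel, hglue i hi]
  intro i hi y hy
  rw [← intervalIntegral.integral_add_adjacent_intervals (hφi (x 0) (x i)) (hφi (x i) y),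
    ← add_assoc, hnode i hi, hstep i hi y hy, add_sub_cancel]

theorem exists_glue {N : ℕ} {x : ℕ → ℝ} (hx : ∀ i < N, x i < x (i + 1)) {f : ℕ → ℝ → ℝ}
    (hf : ∀ i < N, Continuous (f i)) :
    ∃ φ : ℝ → ℝ, (∀ p q, IntervalIntegrable φ MeasureTheory.volume p q) ∧
      ∀ i < N, ∀ t ∈ Set.Ioc (x i) (x (i + 1)), φ t = f i t := by
  have hmono := mesh_mono hx
  refine ⟨fun t => ∑ i ∈ Finset.range N, (Set.Ioc (x i) (x (i + 1))).indicator (f i) t, ?_, ?_⟩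
  · intro p q
    refine intervalIntegrable_iff.2 (MeasureTheory.integrable_finsetSum _ fun i hi => ?_)
    have := intervalIntegrable_iff.1 ((hf i (Finset.mem_range.1 hi)).intervalIntegrable
      (μ := MeasureTheory.volume) p q)
    exact MeasureTheory.Integrable.indicator this measurableSet_Ioc
  · intro i hi t ht
    have hsum := Finset.sum_eq_single (s := Finset.range N)
      (f := fun j => (Set.Ioc (x j) (x (j + 1))).indicator (f j) t) i
      (fun j hj hji => ?_) (fun h => absurd (Finset.mem_range.2 hi) h)
    · exact hsum.trans (Set.indicator_of_mem ht _)
    · refine Set.indicator_of_notMem (fun hmem => ?_) _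
      rcases Nat.lt_or_gt_of_ne hji with h | h
      · exact absurd (ht.1.trans_le hmem.2) (not_lt.2 (hmono i hi.le (j + 1) h))
      · exact absurd (hmem.1.trans_le ht.2)
          (not_lt.2 (hmono j (Finset.mem_range.1 hj).le (i + 1) h))

theorem integral_abs_le_of_integral_sq_le {p q ρ : ℝ} (hpq : p ≤ q) (hρ : 0 ≤ ρ) {r : ℝ → ℝ}
    (hr : Continuous r) (h : ∫ t in p..q, r t ^ 2 ≤ (q - p) * ρ ^ 2) :
    ∫ t in p..q, |r t| ≤ (q - p) * ρ := by
  have hstep : ∀ σ : ℝ, ρ < σ → ∫ t in p..q, |r t| ≤ (q - p) * σ := by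
    intro σ hσ
    have hσ0 : 0 < σ := hρ.trans_lt hσ
    have h1 : ∫ t in p..q, |r t| ≤ ∫ t in p..q, (1 / (2 * σ) * r t ^ 2 + σ / 2) := by
      refine intervalIntegral.integral_mono_on hpq (hr.abs.intervalIntegrable _ _)
        (Continuous.intervalIntegrable (by fun_prop) _ _) fun t _ => ?_
      rw [← sub_nonneg]
      have : 1 / (2 * σ) * r t ^ 2 + σ / 2 - |r t| = (|r t| - σ) ^ 2 / (2 * σ) := by
        rw [← sq_abs (r t)]; field_simp; ring
      rw [this]; positivity
    rw [intervalIntegral.integral_add (Continuous.intervalIntegrable (by fun_prop) _ _)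
      (by simp), intervalIntegral.integral_const_mul, intervalIntegral.integral_const,
      smul_eq_mul] at h1
    have h2 : ∫ t in p..q, r t ^ 2 ≤ (q - p) * σ ^ 2 :=
      h.trans (mul_le_mul_of_nonneg_left (by gcongr) (sub_nonneg.2 hpq))
    have h3 := mul_le_mul_of_nonneg_left h2 (by positivity : 0 ≤ 1 / (2 * σ))
    have h4 : 1 / (2 * σ) * ((q - p) * σ ^ 2) = (q - p) * (σ / 2) := by field_simp
    linarith
  refine le_of_forall_pos_le_add fun δ hδ => ?_
  have hpos : 0 < q - p + 1 := by linarith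
  have := hstep (ρ + δ / (q - p + 1)) (by linarith [div_pos hδ hpos])
  have h5 : (q - p) * (δ / (q - p + 1)) ≤ δ := by
    rw [mul_div_assoc', div_le_iff₀ hpos]; nlinarith
  linarith

theorem integral_sq_le_of_orthogonal {p q B : ℝ} (hpq : p ≤ q) {r g : ℝ → ℝ}
    (hr : Continuous r) (hg : Continuous g) (horth : ∫ t in p..q, r t * (r t - g t) = 0)
    (hB : ∀ t ∈ Set.Icc p q, |g t| ≤ B) : ∫ t in p..q, r t ^ 2 ≤ (q - p) * B ^ 2 := by
  have h1 : ∫ t in p..q, r t ^ 2 = ∫ t in p..q, (2 * (r t * g t) - r t ^ 2) := by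
    have h2 : ∫ t in p..q, (r t ^ 2 - (2 * (r t * g t) - r t ^ 2))
        = 2 * ∫ t in p..q, r t * (r t - g t) := by
      rw [← intervalIntegral.integral_const_mul]
      refine intervalIntegral.integral_congr fun t _ => ?_
      ring
    rw [intervalIntegral.integral_sub (Continuous.intervalIntegrable (by fun_prop) _ _)
      (Continuous.intervalIntegrable (by fun_prop) _ _), horth] at h2
    linarith
  rw [h1]
  have h3 : ∫ t in p..q, (2 * (r t * g t) - r t ^ 2) ≤ ∫ _ in p..q, B ^ 2 := by
    refine intervalIntegral.integral_mono_on hpq (Continuous.intervalIntegrable (by fun_prop) _ _)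
      (by simp) fun t ht => ?_
    have := sq_le_sq' (abs_le.1 (hB t ht)).1 (abs_le.1 (hB t ht)).2
    nlinarith [sq_nonneg (r t - g t)]
  simpa using h3

/-- The first two primitives of a function orthogonal to the affine functions vanish at both ends
of the interval. -/
theorem primitives_of_orthogonal_affine {p q B : ℝ} {r : ℝ → ℝ}
    (hr : Continuous r) (h0 : ∫ t in p..q, r t = 0) (h1 : ∫ t in p..q, r t * t = 0)
    (hB : ∫ t in p..q, |r t| ≤ B) :
    (∫ s in p..q, ∫ t in p..s, r t = 0) ∧
    (∀ y ∈ Set.Icc p q, |∫ t in p..y, r t| ≤ B) ∧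
    ∀ y ∈ Set.Icc p q, |∫ s in p..y, ∫ t in p..s, r t| ≤ (q - p) * B := by
  have hRb : ∀ y ∈ Set.Icc p q, |∫ t in p..y, r t| ≤ B := by
    intro y hy
    refine (intervalIntegral.abs_integral_le_integral_abs hy.1).trans (le_trans ?_ hB)
    exact intervalIntegral.integral_mono_interval le_rfl hy.1 hy.2
      (Filter.Eventually.of_forall fun t => abs_nonneg _) (hr.abs.intervalIntegrable _ _)
  refine ⟨?_, hRb, ?_⟩
  · have hparts := intervalIntegral.integral_mul_deriv_eq_deriv_mul (a := p) (b := q)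
      (u := fun y => ∫ t in p..y, r t) (u' := r) (v := fun y => y) (v' := fun _ => 1)
      (fun t _ => (hr.integral_hasStrictDerivAt p t).hasDerivAt) (fun t _ => hasDerivAt_id t)
      (hr.intervalIntegrable _ _) (by simp)
    simpa [h0, h1] using hparts
  · intro y hy
    have hBnn : 0 ≤ B := (abs_nonneg _).trans (hRb y hy)
    have h2 : ‖∫ s in p..y, ∫ t in p..s, r t‖ ≤ B * |y - p| := by
      refine intervalIntegral.norm_integral_le_of_norm_le_const fun t ht => ?_
      rw [Set.uIoc_of_le hy.1] at ht
      exact hRb t ⟨ht.1.le, ht.2.trans hy.2⟩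
    refine h2.trans ?_
    rw [abs_of_nonneg (by linarith [hy.1]), mul_comm]
    exact mul_le_mul_of_nonneg_right (by linarith [hy.2]) hBnn

theorem exists_polynomial_abs_sub_le {f : ℝ → ℝ} {n : ℕ} (hf : ContDiff ℝ (n + 1) f)
    {p q M : ℝ} (hpq : p < q) (hM : ∀ y ∈ Set.Icc p q, |iteratedDeriv (n + 1) f y| ≤ M) :
    ∃ T : Polynomial ℝ, T.natDegree ≤ n ∧
      ∀ y ∈ Set.Icc p q, |f y - T.eval y| ≤ M * (q - p) ^ (n + 1) := by
  have hM0 : 0 ≤ M := (abs_nonneg _).trans (hM p ⟨le_rfl, hpq.le⟩)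
  refine ⟨∑ j ∈ Finset.range (n + 1), Polynomial.C (((j.factorial : ℝ))⁻¹ *
    iteratedDerivWithin j f (Set.Icc p q) p) * (Polynomial.X - Polynomial.C p) ^ j, ?_, ?_⟩
  · refine Polynomial.natDegree_sum_le_of_forall_le _ _ fun j hj => ?_
    refine (Polynomial.natDegree_C_mul_le _ _).trans ?_
    rw [Polynomial.natDegree_pow, Polynomial.natDegree_X_sub_C, mul_one]
    exact Nat.lt_succ_iff.1 (Finset.mem_range.1 hj)
  · intro y hy
    have h1 := taylor_mean_remainder_bound hpq.le hf.contDiffOn hy (C := M) fun t ht => by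
      rw [iteratedDerivWithin_eq_iteratedDeriv (uniqueDiffOn_Icc hpq)
        (by exact_mod_cast hf.contDiffAt) ht]
      exact hM t ht
    rw [taylor_within_apply, Real.norm_eq_abs] at h1
    have h2 : (∑ j ∈ Finset.range (n + 1), Polynomial.C (((j.factorial : ℝ))⁻¹ *
        iteratedDerivWithin j f (Set.Icc p q) p) * (Polynomial.X - Polynomial.C p) ^ j).eval y
        = ∑ j ∈ Finset.range (n + 1), ((j.factorial : ℝ)⁻¹ * (y - p) ^ j) •
          iteratedDerivWithin j f (Set.Icc p q) p := by
      rw [Polynomial.eval_finsetSum]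
      refine Finset.sum_congr rfl fun j _ => ?_
      simp
      ring
    rw [h2]
    refine h1.trans ((div_le_self (mul_nonneg hM0 (pow_nonneg (sub_nonneg.2 hy.1) _)) ?_).trans ?_)
    · exact_mod_cast Nat.one_le_iff_ne_zero.2 n.factorial_ne_zero
    · exact mul_le_mul_of_nonneg_left
        (pow_le_pow_left₀ (sub_nonneg.2 hy.1) (by linarith [hy.2]) _) hM0

/-- Stability of the elementwise error: a residual that is orthogonal to the affine functions on
every element and of size `ρ` produces an error of size `h ^ 2 * ρ` with derivative `h * ρ`. -/
theorem exists_abs_le_of_residual_orthogonal (α β γ d : ℝ) (hα : 0 < α) (hγ : 0 ≤ γ)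
    (hd : 0 < d) :
    ∃ K > 0, ∀ (N : ℕ) (x : ℕ → ℝ) (h ρ : ℝ) (E E' E'' r : ℕ → ℝ → ℝ), 0 ≤ h → h ≤ 1 → 0 ≤ ρ →
      1 ≤ N → x N = x 0 + d → (∀ i < N, x i < x (i + 1)) → (∀ i < N, x (i + 1) - x i ≤ h) →
      (∀ i < N, ∀ t, HasDerivAt (E i) (E' i t) t) →
      (∀ i < N, ∀ t, HasDerivAt (E' i) (E'' i t) t) → (∀ i < N, Continuous (E'' i)) →
      (∀ i, i + 1 < N → E i (x (i + 1)) = E (i + 1) (x (i + 1))) →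
      (∀ i, i + 1 < N → E' i (x (i + 1)) = E' (i + 1) (x (i + 1))) →
      E 0 (x 0) = 0 → E (N - 1) (x N) = 0 →
      (∀ i < N, ∀ t, r i t = -α * E'' i t + β * E' i t + γ * E i t) →
      (∀ i < N, ∫ t in (x i)..(x (i + 1)), r i t = 0) →
      (∀ i < N, ∫ t in (x i)..(x (i + 1)), r i t * t = 0) →
      (∀ i < N, ∫ t in (x i)..(x (i + 1)), r i t ^ 2 ≤ (x (i + 1) - x i) * ρ ^ 2) →
      ∀ i < N, ∀ y ∈ Set.Icc (x i) (x (i + 1)),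
        |E i y| ≤ K * (h ^ 2 * ρ) ∧ |E' i y| ≤ K * (h * ρ) := by
  obtain ⟨K, hK, hKb⟩ := exists_abs_le_of_primitives_le α β γ d hα hγ hd
  refine ⟨K, hK, ?_⟩
  intro N x h ρ E E' E'' r hh hh1 hρ hN hxN hx hxh hE hE' hE''c hgE hgE' hE0 hEN hr hr0 hr1 hr2
  have hEc : ∀ i < N, Continuous (E i) := fun i hi =>
    continuous_iff_continuousAt.2 fun t => (hE i hi t).continuousAt
  have hE'c : ∀ i < N, Continuous (E' i) := fun i hi =>
    continuous_iff_continuousAt.2 fun t => (hE' i hi t).continuousAt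
  have hrc : ∀ i < N, Continuous (r i) := fun i hi => by
    rw [funext (hr i hi)]
    have := hEc i hi
    have := hE'c i hi
    have := hE''c i hi
    fun_prop
  obtain ⟨ε, hεi, hε⟩ := exists_glue hx hE''c
  set v : ℝ → ℝ := fun y => E' 0 (x 0) + ∫ t in (x 0)..y, ε t with hv
  have hvE : ∀ i < N, ∀ y ∈ Set.Icc (x i) (x (i + 1)), v y = E' i y :=
    eq_add_integral_of_hasDerivAt_pieces hx hεi hE' hε hgE'
  have hvc : Continuous v :=
    continuous_const.add (intervalIntegral.continuous_primitive hεi (x 0))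
  set e : ℝ → ℝ := fun y => ∫ t in (x 0)..y, v t with he
  have heE : ∀ i < N, ∀ y ∈ Set.Icc (x i) (x (i + 1)), e y = E i y := by
    have := eq_add_integral_of_hasDerivAt_pieces hx (fun p q => hvc.intervalIntegrable p q) hE
      (fun i hi t ht => hvE i hi t ⟨ht.1.le, ht.2⟩) hgE
    simpa [hE0] using this
  have hec : Continuous e :=
    intervalIntegral.continuous_primitive (fun p q => hvc.intervalIntegrable p q) (x 0)
  set res : ℝ → ℝ := fun y => -α * ε y + β * v y + γ * e y with hres
  have hresi : ∀ p q, IntervalIntegrable res MeasureTheory.volume p q := fun p q =>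
    (((hεi p q).const_mul (-α)).add ((hvc.const_mul β).intervalIntegrable p q)).add
      ((hec.const_mul γ).intervalIntegrable p q)
  have hresr : ∀ i < N, ∀ t ∈ Set.Ioc (x i) (x (i + 1)), res t = r i t := by
    intro i hi t ht
    simp only [hres]
    rw [hr i hi, hε i hi t ht, hvE i hi t ⟨ht.1.le, ht.2⟩, heE i hi t ⟨ht.1.le, ht.2⟩]
  have hloc := fun i (hi : i < N) => primitives_of_orthogonal_affine (hrc i hi)
    (hr0 i hi) (hr1 i hi) ((integral_abs_le_of_integral_sq_le (hx i hi).le hρ (hrc i hi)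
      (hr2 i hi)).trans (mul_le_mul_of_nonneg_right (hxh i hi) hρ))
  have hprim : ∀ i < N, Continuous fun y => ∫ t in (x i)..y, r i t := fun i hi =>
    intervalIntegral.continuous_primitive (fun p q => (hrc i hi).intervalIntegrable p q) _
  set R : ℝ → ℝ := fun y => ∫ t in (x 0)..y, res t with hR
  have hRE : ∀ i < N, ∀ y ∈ Set.Icc (x i) (x (i + 1)), R y = ∫ t in (x i)..y, r i t := by
    have := eq_add_integral_of_hasDerivAt_pieces (F := fun i y => ∫ t in (x i)..y, r i t)
      hx hresi (fun i hi t => ((hrc i hi).integral_hasStrictDerivAt (x i) t).hasDerivAt) hresr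
      (fun i hi => by rw [hr0 i (by omega), intervalIntegral.integral_same])
    simpa using this
  have hRc : Continuous R := intervalIntegral.continuous_primitive hresi (x 0)
  set T : ℝ → ℝ := fun y => ∫ t in (x 0)..y, R t with hT
  have hTE : ∀ i < N, ∀ y ∈ Set.Icc (x i) (x (i + 1)),
      T y = ∫ s in (x i)..y, ∫ t in (x i)..s, r i t := by
    have := eq_add_integral_of_hasDerivAt_pieces
      (F := fun i y => ∫ s in (x i)..y, ∫ t in (x i)..s, r i t)
      hx (fun p q => hRc.intervalIntegrable p q)
      (fun i hi t => ((hprim i hi).integral_hasStrictDerivAt (x i) t).hasDerivAt)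
      (fun i hi t ht => hRE i hi t ⟨ht.1.le, ht.2⟩)
      (fun i hi => by rw [(hloc i (by omega)).1, intervalIntegral.integral_same])
    simpa using this
  have hfin := hKb (x 0) (E' 0 (x 0)) h ρ ε v e res R T hh hh1 hρ hεi (fun _ => rfl)
    (fun _ => rfl) (fun _ => rfl) (fun _ => rfl) (fun _ => rfl)
    (by
      intro y hy
      obtain ⟨i, hi, hyi⟩ := exists_mem_element hN hy.1 (hy.2.trans hxN.ge)
      rw [hRE i hi y hyi]
      exact (hloc i hi).2.1 y hyi)
    (by
      intro y hy
      obtain ⟨i, hi, hyi⟩ := exists_mem_element hN hy.1 (hy.2.trans hxN.ge)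
      rw [hTE i hi y hyi]
      refine ((hloc i hi).2.2 y hyi).trans ?_
      calc (x (i + 1) - x i) * (h * ρ) ≤ h * (h * ρ) :=
            mul_le_mul_of_nonneg_right (hxh i hi) (by positivity)
        _ = h ^ 2 * ρ := by ring)
    (by
      obtain ⟨m, rfl⟩ : ∃ m, N = m + 1 := ⟨N - 1, by omega⟩
      rw [← hxN, heE m (by omega) _ ⟨(hx m (by omega)).le, le_rfl⟩]
      simpa using hEN)
  intro i hi y hy
  have hmem : y ∈ Set.Icc (x 0) (x 0 + d) :=
    ⟨(mesh_mono hx i hi.le 0 (Nat.zero_le _)).trans hy.1,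
      hxN ▸ hy.2.trans (mesh_mono hx N le_rfl (i + 1) hi)⟩
  have := hfin y hmem
  rwa [heE i hi y hy, hvE i hi y hy] at this

theorem exists_second_deriv_bounds (α β γ K : ℝ) (hα : 0 < α) (hγ : 0 ≤ γ) (hK : 0 < K) :
    ∃ K' > 0, ∀ (p q h ρ : ℝ) (E E' E'' r : ℝ → ℝ), p ≤ q → q - p ≤ h → h ≤ 1 → 0 ≤ ρ →
      (∀ t, HasDerivAt E (E' t) t) → (∀ t, HasDerivAt E' (E'' t) t) → Continuous E'' →
      (∀ t, r t = -α * E'' t + β * E' t + γ * E t) →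
      (∀ y ∈ Set.Icc p q, |E y| ≤ K * (h ^ 2 * ρ) ∧ |E' y| ≤ K * (h * ρ)) →
      ∫ t in p..q, r t ^ 2 ≤ (q - p) * ρ ^ 2 →
      ∫ t in p..q, E'' t ^ 2 ≤ (q - p) * (K' * ρ) ^ 2 ∧
      ∀ y ∈ Set.Icc p q, |β * E' y + γ * E y - (β * E' p + γ * E p)| ≤ K' * (h * ρ) := by
  set m : ℝ := (|β| + γ) * K with hm
  have hm0 : 0 ≤ m := by positivity
  set J : ℝ := 2 * (1 + m) / α with hJ
  have hJpos : 0 < J := by positivity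
  refine ⟨J + |β| * J + 2 * (γ * K), by positivity, ?_⟩
  intro p q h ρ E E' E'' r hpq hqh hh1 hρ hE hE' hE''c hr hb hr2
  have hh : 0 ≤ h := by linarith
  have hEc : Continuous E := continuous_iff_continuousAt.2 fun t => (hE t).continuousAt
  have hE'c : Continuous E' := continuous_iff_continuousAt.2 fun t => (hE' t).continuousAt
  have hrc : Continuous r := by rw [funext hr]; fun_prop
  have hh2 : h ^ 2 * ρ ≤ h * ρ := mul_le_mul_of_nonneg_right (by nlinarith) hρ
  have hhρ : h * ρ ≤ ρ := mul_le_of_le_one_left hρ hh1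
  have hEJ : ∫ t in p..q, E'' t ^ 2 ≤ (q - p) * (J * ρ) ^ 2 := by
    have h1 : ∫ t in p..q, E'' t ^ 2
        ≤ ∫ t in p..q, (2 / α ^ 2 * r t ^ 2 + 2 / α ^ 2 * (m * ρ) ^ 2) := by
      refine intervalIntegral.integral_mono_on hpq
        (Continuous.intervalIntegrable (by fun_prop) _ _)
        (Continuous.intervalIntegrable (by fun_prop) _ _) fun t ht => ?_
      have h2 : |β * E' t + γ * E t| ≤ m * ρ := by
        refine (abs_add_le _ _).trans ?_
        rw [abs_mul, abs_mul, abs_of_nonneg hγ, hm]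
        have h3 : |E t| ≤ K * ρ :=
          (hb t ht).1.trans (mul_le_mul_of_nonneg_left (hh2.trans hhρ) hK.le)
        have h4 : |E' t| ≤ K * ρ := (hb t ht).2.trans (mul_le_mul_of_nonneg_left hhρ hK.le)
        have h5 := mul_le_mul_of_nonneg_left h3 hγ
        have h6 := mul_le_mul_of_nonneg_left h4 (abs_nonneg β)
        linarith
      have h7 := sq_le_sq' (abs_le.1 h2).1 (abs_le.1 h2).2
      have h8 : E'' t = (β * E' t + γ * E t - r t) / α := by rw [hr t]; field_simp; ring
      have h9 : (β * E' t + γ * E t - r t) ^ 2 ≤ 2 * r t ^ 2 + 2 * (m * ρ) ^ 2 := by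
        nlinarith [sq_nonneg (β * E' t + γ * E t + r t)]
      rw [h8, div_pow, div_le_iff₀ (by positivity)]
      refine h9.trans (le_of_eq ?_)
      field_simp
    rw [intervalIntegral.integral_add (Continuous.intervalIntegrable (by fun_prop) _ _)
      (by simp), intervalIntegral.integral_const_mul, intervalIntegral.integral_const,
      smul_eq_mul] at h1
    have h2 : 2 / α ^ 2 * ∫ t in p..q, r t ^ 2 ≤ 2 / α ^ 2 * ((q - p) * ρ ^ 2) :=
      mul_le_mul_of_nonneg_left hr2 (by positivity)
    have h3 : (q - p) * (J * ρ) ^ 2 - (2 / α ^ 2 * ((q - p) * ρ ^ 2)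
        + (q - p) * (2 / α ^ 2 * (m * ρ) ^ 2))
        = (q - p) * (2 * ρ ^ 2 * (1 + 4 * m + m ^ 2) / α ^ 2) := by
      rw [hJ]; field_simp; ring
    have h4 : 0 ≤ (q - p) * (2 * ρ ^ 2 * (1 + 4 * m + m ^ 2) / α ^ 2) :=
      mul_nonneg (sub_nonneg.2 hpq) (by positivity)
    linarith
  constructor
  · refine hEJ.trans (mul_le_mul_of_nonneg_left ?_ (sub_nonneg.2 hpq))
    have : J ≤ J + |β| * J + 2 * (γ * K) := by
      have : 0 ≤ |β| * J + 2 * (γ * K) := by positivity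
      linarith
    gcongr
  · intro y hy
    have hp : p ∈ Set.Icc p q := ⟨le_rfl, hpq⟩
    have h1 : |E' y - E' p| ≤ J * (h * ρ) := by
      rw [← intervalIntegral.integral_eq_sub_of_hasDerivAt (fun t _ => hE' t)
        (hE''c.intervalIntegrable p y)]
      have h2 := integral_abs_le_of_integral_sq_le hpq (by positivity : 0 ≤ J * ρ) hE''c hEJ
      have h3 : ∫ t in p..y, |E'' t| ≤ ∫ t in p..q, |E'' t| :=
        intervalIntegral.integral_mono_interval le_rfl hy.1 hy.2
          (Filter.Eventually.of_forall fun t => abs_nonneg _) (hE''c.abs.intervalIntegrable _ _)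
      have h4 := intervalIntegral.abs_integral_le_integral_abs (f := E'')
        (μ := MeasureTheory.volume) hy.1
      have h5 : (q - p) * (J * ρ) ≤ h * (J * ρ) :=
        mul_le_mul_of_nonneg_right hqh (by positivity)
      linarith
    have h2 : |E y - E p| ≤ 2 * K * (h * ρ) := by
      have h3 := mul_le_mul_of_nonneg_left hh2 hK.le
      have h4 := abs_sub (E y) (E p)
      linarith [(hb y hy).1, (hb p hp).1]
    have h3 : β * E' y + γ * E y - (β * E' p + γ * E p)
        = β * (E' y - E' p) + γ * (E y - E p) := by ring
    rw [h3]
    refine (abs_add_le _ _).trans ?_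
    rw [abs_mul, abs_mul, abs_of_nonneg hγ]
    have h4 := mul_le_mul_of_nonneg_left h1 (abs_nonneg β)
    have h5 := mul_le_mul_of_nonneg_left h2 hγ
    have h6 : 0 ≤ J * (h * ρ) := by positivity
    linarith

theorem integral_residual_sq_le {α β γ p q τ η : ℝ} {n : ℕ} (hα : 0 < α) (hpq : p ≤ q)
    {E E' U r : ℝ → ℝ} {D T : Polynomial ℝ} (hr : Continuous r) (hD : D.natDegree ≤ n)
    (hT : T.natDegree ≤ n)
    (hrE : ∀ t, r t = -α * (U t - D.eval t) + β * E' t + γ * E t)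
    (horth : ∀ Q : Polynomial ℝ, Q.natDegree ≤ n → ∫ t in p..q, r t * Q.eval t = 0)
    (hUT : ∀ t ∈ Set.Icc p q, |U t - T.eval t| ≤ τ)
    (hosc : ∀ t ∈ Set.Icc p q, |β * E' t + γ * E t - (β * E' p + γ * E p)| ≤ η) :
    ∫ t in p..q, r t ^ 2 ≤ (q - p) * (α * τ + η) ^ 2 := by
  set Q : Polynomial ℝ := Polynomial.C α * (D - T) + Polynomial.C (β * E' p + γ * E p) with hQ
  have hQdeg : Q.natDegree ≤ n := by
    refine (Polynomial.natDegree_add_le _ _).trans (max_le ?_ (by rw [Polynomial.natDegree_C]; exact Nat.zero_le _))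
    exact (Polynomial.natDegree_C_mul_le _ _).trans
      ((Polynomial.natDegree_sub_le _ _).trans (max_le hD hT))
  refine integral_sq_le_of_orthogonal hpq (g := fun t => r t - Q.eval t) hr
    (hr.sub Q.continuous) (by simpa using horth Q hQdeg) fun t ht => ?_
  have h1 : r t - Q.eval t = -α * (U t - T.eval t)
      + (β * E' t + γ * E t - (β * E' p + γ * E p)) := by
    rw [hrE t, hQ]
    simp
    ring
  rw [h1]
  refine (abs_add_le _ _).trans (add_le_add ?_ (hosc t ht))
  rw [abs_mul, abs_neg, abs_of_pos hα]
  exact mul_le_mul_of_nonneg_left (hUT t ht) hα.le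

theorem IsPGSol.integral_residual_mul_eq_zero {k N : ℕ} {x : ℕ → ℝ} {α β γ : ℝ} {f : ℝ → ℝ}
    {P : ℕ → Polynomial ℝ} (hP : IsPGSol k N x α β γ f P) (hf : Continuous f) {i : ℕ}
    (hi : i < N) {q : Polynomial ℝ} (hq : q.natDegree ≤ k - 2) :
    ∫ t in (x i)..(x (i + 1)), (f t - (-α * (P (i + 1)).derivative.derivative.eval t
      + β * (P (i + 1)).derivative.eval t + γ * (P (i + 1)).eval t)) * q.eval t = 0 := by
  have h := hP.2 (fun j => if j = i + 1 then q else 0) fun j _ => by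
    split_ifs
    · exact hq
    · simp
  have hmem : i + 1 ∈ Finset.Icc 1 N := Finset.mem_Icc.2 ⟨by omega, by omega⟩
  rw [Finset.sum_eq_single_of_mem _ hmem fun j _ hj => by simp [hj],
    Finset.sum_eq_single_of_mem _ hmem fun j _ hj => by simp [hj]] at h
  simp only [if_true, Nat.add_sub_cancel] at h
  have h2 : ∀ t, (f t - (-α * (P (i + 1)).derivative.derivative.eval t
      + β * (P (i + 1)).derivative.eval t + γ * (P (i + 1)).eval t)) * q.eval t
      = f t * q.eval t - (-α * (P (i + 1)).derivative.derivative.eval t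
      + β * (P (i + 1)).derivative.eval t + γ * (P (i + 1)).eval t) * q.eval t := fun t => by ring
  simp only [h2]
  rw [intervalIntegral.integral_sub (Continuous.intervalIntegrable (by fun_prop) _ _)
    (Continuous.intervalIntegrable (by fun_prop) _ _), h, sub_self]

/-- Optimal error estimates for the C¹ Petrov–Galerkin method: there are constants
`C, h₀ > 0` depending only on `k, α, β, γ, b - a = d` and the quasi-uniformity constant `c`,
such that for `h ≤ h₀`, `‖u - u_h‖_{0,∞} ≤ C h^{k+1} |u|_{k+1,∞}`,
`‖u - u_h‖_{1,∞} ≤ C h^k |u|_{k+1,∞}` and `‖u - u_h‖_2 ≤ C h^{k-1} |u|_{k+1,∞}`. -/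
theorem petrov_galerkin_optimal_estimates (k : ℕ) (hk : 3 ≤ k)
    (α β γ c d : ℝ) (hα : 0 < α) (hγ : 0 ≤ γ) (hc : 1 ≤ c) (hd : 0 < d) :
    ∃ C > 0, ∃ h₀ > 0, ∀ (a b : ℝ), b - a = d →
      ∀ (N : ℕ) (x : ℕ → ℝ) (h : ℝ),
        IsMesh a b N x → IsMeshSize N x h → IsQuasiUniform N x h c → h ≤ h₀ →
      ∀ u : ℝ → ℝ, ContDiff ℝ (k + 1) u → u a = 0 → u b = 0 →
      ∀ P : ℕ → Polynomial ℝ,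
        IsPGSol k N x α β γ (fun t => -α * iteratedDeriv 2 u t + β * deriv u t + γ * u t) P →
      ∀ M : ℝ, (∀ y ∈ Set.Ioo a b, |iteratedDeriv (k + 1) u y| ≤ M) →
        (∀ i ∈ Finset.Icc 1 N, ∀ y ∈ Set.Icc (x (i - 1)) (x i),
            |u y - (P i).eval y| ≤ C * h ^ (k + 1) * M ∧
            |deriv u y - (Polynomial.derivative (P i)).eval y| ≤ C * h ^ k * M) ∧
        Real.sqrt (∑ i ∈ Finset.Icc 1 N, ∫ t in (x (i - 1))..(x i),
              ((u t - (P i).eval t) ^ 2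
                + (deriv u t - (Polynomial.derivative (P i)).eval t) ^ 2
                + (iteratedDeriv 2 u t
                    - (Polynomial.derivative (Polynomial.derivative (P i))).eval t) ^ 2))
          ≤ C * h ^ (k - 1) * M := by
  obtain ⟨n, rfl⟩ : ∃ n, k = n + 2 := ⟨k - 2, by omega⟩
  have hn : 1 ≤ n := by omega
  obtain ⟨K, hK, hstab⟩ := exists_abs_le_of_residual_orthogonal α β γ d hα hγ hd
  obtain ⟨K', hK', hsecond⟩ := exists_second_deriv_bounds α β γ K hα hγ hK
  refine ⟨2 * α * K + Real.sqrt d * (2 * K + K') * (2 * α), by positivity,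
    min 1 (1 / (2 * K')), by positivity, ?_⟩
  intro a b hab N x h hmesh hsize _ hh₀ u hu hua hub P hP M hM
  obtain ⟨hN, hx0, hxN, hx⟩ := hmesh
  have hh1 : h ≤ 1 := hh₀.trans (min_le_left _ _)
  have hhK : K' * h ≤ 1 / 2 := by
    have h1 := mul_le_mul_of_nonneg_left (hh₀.trans (min_le_right _ _)) hK'.le
    refine h1.trans (le_of_eq ?_)
    field_simp
  have hxh : ∀ i < N, x (i + 1) - x i ≤ h := fun i hi => by
    simpa using hsize.1 (i + 1) (Finset.mem_Icc.2 ⟨by omega, by omega⟩)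
  have hh : 0 < h := (sub_pos.2 (hx 0 (by omega))).trans_le (hxh 0 (by omega))
  have hxa : ∀ i ≤ N, a ≤ x i := fun i hi => hx0 ▸ mesh_mono hx i hi 0 (Nat.zero_le _)
  have hxb : ∀ i ≤ N, x i ≤ b := fun i hi => hxN ▸ mesh_mono hx N le_rfl i hi
  have hablt : a < b := by linarith
  have hu' : ContDiff ℝ ((n + 3 : ℕ)) u := by
    refine hu.of_le (le_of_eq ?_)
    push_cast
    rw [add_assoc]
    norm_num
  have hu2 : iteratedDeriv 2 u = deriv (deriv u) := by rw [iteratedDeriv_eq_iterate]; rfl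
  have hu2C : ContDiff ℝ ((n + 1 : ℕ)) (iteratedDeriv 2 u) := by
    rw [iteratedDeriv_eq_iterate]
    exact ContDiff.iterate_deriv' (n + 1) 2 hu'
  have hu1C : ContDiff ℝ ((n + 2 : ℕ)) (deriv u) := ContDiff.iterate_deriv' (n + 2) 1 hu'
  have hud : ∀ t, HasDerivAt u (deriv u t) t := fun t =>
    (hu'.differentiable (by simp) t).hasDerivAt
  have hudd : ∀ t, HasDerivAt (deriv u) (iteratedDeriv 2 u t) t := fun t => by
    rw [hu2]
    exact (hu1C.differentiable (by simp) t).hasDerivAt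
  have hM' : ∀ y ∈ Set.Icc a b, |iteratedDeriv (n + 1) (iteratedDeriv 2 u) y| ≤ M := by
    have hit : iteratedDeriv (n + 1) (iteratedDeriv 2 u) = iteratedDeriv (n + 2 + 1) u := by
      rw [iteratedDeriv_eq_iterate, iteratedDeriv_eq_iterate, iteratedDeriv_eq_iterate,
        ← Function.iterate_add_apply]
    rw [hit]
    have hcl : IsClosed {y | |iteratedDeriv (n + 2 + 1) u y| ≤ M} :=
      isClosed_le (hu'.continuous_iteratedDeriv (n + 3) le_rfl).abs continuous_const
    rw [← closure_Ioo hablt.ne]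
    exact fun y hy => closure_minimal (fun t ht => hM t ht) hcl hy
  have hM0 : 0 ≤ M := (abs_nonneg _).trans (hM' a ⟨le_rfl, hablt.le⟩)
  set E : ℕ → ℝ → ℝ := fun i t => u t - (P (i + 1)).eval t with hE
  set E' : ℕ → ℝ → ℝ := fun i t => deriv u t - (P (i + 1)).derivative.eval t with hE'
  set E'' : ℕ → ℝ → ℝ := fun i t =>
    iteratedDeriv 2 u t - (P (i + 1)).derivative.derivative.eval t with hE''
  set r : ℕ → ℝ → ℝ := fun i t => -α * E'' i t + β * E' i t + γ * E i t with hr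
  have hEd : ∀ i < N, ∀ t, HasDerivAt (E i) (E' i t) t := fun i _ t =>
    (hud t).sub ((P (i + 1)).hasDerivAt t)
  have hE'd : ∀ i < N, ∀ t, HasDerivAt (E' i) (E'' i t) t := fun i _ t =>
    (hudd t).sub ((P (i + 1)).derivative.hasDerivAt t)
  have huc := hu'.continuous
  have hu1c := hu1C.continuous
  have hu2c := hu2C.continuous
  have hE''c : ∀ i < N, Continuous (E'' i) := fun i _ => by fun_prop
  have hE'c : ∀ i < N, Continuous (E' i) := fun i _ => by fun_prop
  have hEc : ∀ i < N, Continuous (E i) := fun i _ => by fun_prop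
  have hrc : ∀ i < N, Continuous (r i) := fun i _ => by fun_prop
  have horth : ∀ i < N, ∀ q : Polynomial ℝ, q.natDegree ≤ n →
      ∫ t in (x i)..(x (i + 1)), r i t * q.eval t = 0 := by
    intro i hi q hq
    rw [← hP.integral_residual_mul_eq_zero (by fun_prop) hi (q := q) (by simpa using hq)]
    refine intervalIntegral.integral_congr fun t _ => ?_
    simp only [hr, hE, hE', hE'']
    ring
  have hlen : ∀ i < N, 0 < x (i + 1) - x i := fun i hi => sub_pos.2 (hx i hi)
  obtain ⟨m, hm, hmax⟩ := Finset.exists_max_image (Finset.range N)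
    (fun i => Real.sqrt ((∫ t in (x i)..(x (i + 1)), r i t ^ 2) / (x (i + 1) - x i)))
    ⟨0, Finset.mem_range.2 (by omega)⟩
  have hm := Finset.mem_range.1 hm
  set ρ : ℝ := Real.sqrt ((∫ t in (x m)..(x (m + 1)), r m t ^ 2) / (x (m + 1) - x m)) with hρdef
  have hρ : 0 ≤ ρ := Real.sqrt_nonneg _
  have hr2 : ∀ i < N, ∫ t in (x i)..(x (i + 1)), r i t ^ 2 ≤ (x (i + 1) - x i) * ρ ^ 2 := by
    intro i hi
    have h1 := hmax i (Finset.mem_range.2 hi)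
    rw [Real.sqrt_le_left hρ, div_le_iff₀ (hlen i hi)] at h1
    linarith
  have hbound := hstab N x h ρ E E' E'' r hh.le hh1 hρ hN (by linarith) hx hxh hEd hE'd hE''c
    (fun i hi => by
      have := hP.1.2.1 (i + 1) (Finset.mem_Icc.2 ⟨by omega, by omega⟩)
      simp only [hE, this])
    (fun i hi => by
      have := hP.1.2.2.1 (i + 1) (Finset.mem_Icc.2 ⟨by omega, by omega⟩)
      simp only [hE', this])
    (by
      have := hP.1.2.2.2.1
      rw [hx0] at this
      simp only [hE, zero_add, hx0, hua, this, sub_zero])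
    (by
      have := hP.1.2.2.2.2
      simp only [hE]
      rw [Nat.sub_add_cancel hN, this, hxN, hub, sub_zero])
    (fun _ _ _ => rfl)
    (fun i hi => by simpa using horth i hi 1 (by simp))
    (fun i hi => by simpa using horth i hi Polynomial.X (by simpa using hn))
    hr2
  have hcons := fun i (hi : i < N) => hsecond (x i) (x (i + 1)) h ρ (E i) (E' i) (E'' i) (r i)
    (hx i hi).le (hxh i hi) hh1 hρ (hEd i hi) (hE'd i hi) (hE''c i hi) (fun _ => rfl)
    (hbound i hi) (hr2 i hi)
  have hρle : ρ ≤ 2 * α * (M * h ^ (n + 1)) := by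
    have hsub : ∀ y ∈ Set.Icc (x m) (x (m + 1)), y ∈ Set.Icc a b := fun y hy =>
      ⟨(hxa m hm.le).trans hy.1, hy.2.trans (hxb (m + 1) hm)⟩
    obtain ⟨T, hTdeg, hT⟩ := exists_polynomial_abs_sub_le (f := iteratedDeriv 2 u) (n := n)
      (by exact_mod_cast hu2C) (hx m hm) (fun y hy => hM' y (hsub y hy))
    have hPdeg := hP.1.1 (m + 1) (Finset.mem_Icc.2 ⟨by omega, by omega⟩)
    have h1 := integral_residual_sq_le (D := (P (m + 1)).derivative.derivative)
      (τ := M * h ^ (n + 1)) hα (hx m hm).le (hrc m hm)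
      (by
        have h2 := Polynomial.natDegree_derivative_le (P (m + 1)).derivative
        have h3 := Polynomial.natDegree_derivative_le (P (m + 1))
        omega)
      hTdeg (fun _ => rfl) (horth m hm)
      (fun t ht => (hT t ht).trans (mul_le_mul_of_nonneg_left
        (pow_le_pow_left₀ (hlen m hm).le (hxh m hm) _) hM0))
      (hcons m hm).2
    have h2 : ρ ≤ α * (M * h ^ (n + 1)) + K' * (h * ρ) := by
      rw [hρdef]
      refine Real.sqrt_le_iff.2 ⟨by positivity, ?_⟩
      rw [← hρdef, div_le_iff₀ (hlen m hm), mul_comm]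
      exact h1
    have h3 : K' * h * ρ ≤ 1 / 2 * ρ := mul_le_mul_of_nonneg_right hhK hρ
    linarith
  have hsqrt : 0 ≤ Real.sqrt d * (2 * K + K') * (2 * α) := by positivity
  constructor
  · intro i hi y hy
    obtain ⟨hi1, hiN⟩ := Finset.mem_Icc.1 hi
    obtain ⟨j, rfl⟩ : ∃ j, i = j + 1 := ⟨i - 1, by omega⟩
    obtain ⟨h1, h2⟩ := hbound j (by omega) y (by simpa using hy)
    constructor
    · refine h1.trans ?_
      calc K * (h ^ 2 * ρ) ≤ K * (h ^ 2 * (2 * α * (M * h ^ (n + 1)))) := by gcongr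
        _ = (2 * α * K) * h ^ (n + 2 + 1) * M := by ring
        _ ≤ _ := by gcongr; linarith
    · refine h2.trans ?_
      calc K * (h * ρ) ≤ K * (h * (2 * α * (M * h ^ (n + 1)))) := by gcongr
        _ = (2 * α * K) * h ^ (n + 2) * M := by ring
        _ ≤ _ := by gcongr; linarith
  · have hh2 : h ^ 2 * ρ ≤ ρ := mul_le_of_le_one_left hρ (pow_le_one₀ hh.le hh1)
    have hh3 : h * ρ ≤ ρ := mul_le_of_le_one_left hρ hh1
    have helem : ∀ i < N, ∫ t in (x i)..(x (i + 1)), (E i t ^ 2 + E' i t ^ 2 + E'' i t ^ 2)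
        ≤ (x (i + 1) - x i) * ((2 * K + K') * ρ) ^ 2 := by
      intro i hi
      have hc := hEc i hi
      have hc' := hE'c i hi
      have hc'' := hE''c i hi
      have h1 : ∫ t in (x i)..(x (i + 1)), (E i t ^ 2 + E' i t ^ 2)
          ≤ ∫ _ in (x i)..(x (i + 1)), 2 * (K * ρ) ^ 2 := by
        refine intervalIntegral.integral_mono_on (hx i hi).le
          (Continuous.intervalIntegrable (by fun_prop) _ _) (by simp) fun t ht => ?_
        obtain ⟨h2, h3⟩ := hbound i hi t ht
        have h4 := abs_le.1 (h2.trans (mul_le_mul_of_nonneg_left hh2 hK.le))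
        have h5 := abs_le.1 (h3.trans (mul_le_mul_of_nonneg_left hh3 hK.le))
        linarith [sq_le_sq' h4.1 h4.2, sq_le_sq' h5.1 h5.2]
      rw [intervalIntegral.integral_const, smul_eq_mul] at h1
      rw [intervalIntegral.integral_add (Continuous.intervalIntegrable (by fun_prop) _ _)
        (Continuous.intervalIntegrable (by fun_prop) _ _)]
      have h6 : 0 ≤ (x (i + 1) - x i) * ((2 * K ^ 2 + 4 * K * K') * ρ ^ 2) :=
        mul_nonneg (hlen i hi).le (by positivity)
      linarith [(hcons i hi).1]
    have hsum : ∑ i ∈ Finset.Icc 1 N, ∫ t in (x (i - 1))..(x i),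
        ((u t - (P i).eval t) ^ 2 + (deriv u t - (P i).derivative.eval t) ^ 2
          + (iteratedDeriv 2 u t - (P i).derivative.derivative.eval t) ^ 2)
        ≤ d * ((2 * K + K') * ρ) ^ 2 := by
      have hreidx : Finset.Icc 1 N = (Finset.range N).image (· + 1) := by
        ext i
        simp only [Finset.mem_Icc, Finset.mem_image, Finset.mem_range]
        exact ⟨fun hi => ⟨i - 1, by omega, by omega⟩, by rintro ⟨j, hj, rfl⟩; omega⟩
      rw [hreidx, Finset.sum_image (fun i _ j _ hij => by simpa using hij)]
      refine (Finset.sum_le_sum fun i hi => helem i (Finset.mem_range.1 hi)).trans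
        (le_of_eq ?_)
      rw [← Finset.sum_mul, Finset.sum_range_sub, hx0, hxN, hab]
    refine (Real.sqrt_le_sqrt hsum).trans ?_
    rw [Real.sqrt_mul hd.le, Real.sqrt_sq (by positivity)]
    calc Real.sqrt d * ((2 * K + K') * ρ)
        ≤ Real.sqrt d * ((2 * K + K') * (2 * α * (M * h ^ (n + 1)))) := by gcongr
      _ = (Real.sqrt d * (2 * K + K') * (2 * α)) * h ^ (n + 1) * M := by ring
      _ ≤ (2 * α * K + Real.sqrt d * (2 * K + K') * (2 * α)) * h ^ (n + 2 - 1) * M := by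
        rw [show n + 2 - 1 = n + 1 by omega]
        gcongr
        have : 0 ≤ 2 * α * K := by positivity
        linarith
end
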